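/- arXiv:1309.5599 — 8 statements merged into one kernel-verified Lean document; each statement's English description precedes it below -/
import Mathlib

section
/- Let f : ℕ → ℕ be any function and let a : ℕ → ℕ be the associated f-sequence, i.e., a(0) = 1 and a(n) = a(n−1) + a(n−1−f(n−1)) for n ≥ 1, where a(m) is taken to be 1 whenever m < 0. Then a is strictly increasing, and every positive integer x has exactly one f-decomposition using a, i.e., exactly one finite set S ⊆ ℕ with ∑_{i∈S} a(i) = x such that for any two distinct i, j ∈ S with j < i one has i − j > f(i). -/
/-- The `f`-sequence associated to `f : ℕ → ℕ`: `a 0 = 1` and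
`a n = a (n-1) + a (n-1-f(n-1))` for `n ≥ 1`, where terms with negative index are `1`. -/
def fSeq (f : ℕ → ℕ) : ℕ → ℕ
  | 0 => 1
  | n + 1 => fSeq f n + (if f n ≤ n then fSeq f (n - f n) else 1)
  decreasing_by all_goals omega

/-- A finite set of indices `S` is `f`-legal if for any two distinct `i, j ∈ S` with `j < i`
one has `i - j > f i`. -/
def FLegal (f : ℕ → ℕ) (S : Finset ℕ) : Prop :=
  ∀ i ∈ S, ∀ j ∈ S, j < i → f i < i - j

theorem fSeq_succ (f : ℕ → ℕ) (n : ℕ) : fSeq f (n + 1) = fSeq f n + fSeq f (n - f n) := by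
  rw [fSeq]
  split_ifs with h
  · rfl
  · rw [Nat.sub_eq_zero_of_le (by omega : n ≤ f n), fSeq]

theorem fSeq_pos (f : ℕ → ℕ) (n : ℕ) : 0 < fSeq f n := by
  induction n with
  | zero => rw [fSeq]; exact one_pos
  | succ n ih => rw [fSeq_succ]; omega

theorem fSeq_strictMono (f : ℕ → ℕ) : StrictMono (fSeq f) :=
  strictMono_nat_of_lt_succ fun n => by
    have := fSeq_pos f (n - f n)
    rw [fSeq_succ]
    omega

theorem FLegal.erase {f : ℕ → ℕ} {S : Finset ℕ} (hS : FLegal f S) (n : ℕ) :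
    FLegal f (S.erase n) :=
  fun i hi j hj => hS i (Finset.mem_of_mem_erase hi) j (Finset.mem_of_mem_erase hj)

theorem FLegal.lt_of_mem_erase {f : ℕ → ℕ} {S : Finset ℕ} {n : ℕ} (hS : FLegal f S)
    (hlt : ∀ i ∈ S, i < n + 1) (hn : n ∈ S) : ∀ i ∈ S.erase n, i < n - f n := by
  intro i hi
  rw [Finset.mem_erase] at hi
  have h₁ := hlt i hi.2
  have h₂ := hS n hn i hi.2 (by omega)
  omega

theorem lt_of_forall_lt_succ_of_notMem {S : Finset ℕ} {n : ℕ}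
    (hlt : ∀ i ∈ S, i < n + 1) (hn : n ∉ S) : ∀ i ∈ S, i < n := by
  intro i hi
  have h₁ := hlt i hi
  have h₂ : i ≠ n := fun h => hn (h ▸ hi)
  omega

/-- A legal sum of terms with indices below `n` is smaller than the `n`-th term. -/
theorem FLegal.sum_lt {f : ℕ → ℕ} (n : ℕ) : ∀ {S : Finset ℕ}, FLegal f S → (∀ i ∈ S, i < n) →
    ∑ i ∈ S, fSeq f i < fSeq f n := by
  induction n using Nat.strong_induction_on with
  | _ n ih =>
    intro S hS hlt
    cases n with
    | zero =>
      have : S = ∅ := Finset.eq_empty_of_forall_notMem fun i hi => by simpa using hlt i hi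
      simpa [this] using fSeq_pos f 0
    | succ n =>
      rw [fSeq_succ]
      by_cases hn : n ∈ S
      · have := ih (n - f n) (by omega) (hS.erase n) (hS.lt_of_mem_erase hlt hn)
        rw [← Finset.add_sum_erase S _ hn]
        omega
      · have := ih n (by omega) hS (lt_of_forall_lt_succ_of_notMem hlt hn)
        omega

/-- Every number below the `n`-th term is a legal sum of terms with indices below `n`. -/
theorem exists_fLegal_sum_eq (f : ℕ → ℕ) (n : ℕ) : ∀ x < fSeq f n,
    ∃ S : Finset ℕ, (∀ i ∈ S, i < n) ∧ FLegal f S ∧ ∑ i ∈ S, fSeq f i = x := by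
  induction n using Nat.strong_induction_on with
  | _ n ih =>
    intro x hx
    cases n with
    | zero =>
      rw [fSeq] at hx
      exact ⟨∅, by simp, by simp [FLegal], by simp; omega⟩
    | succ n =>
      rw [fSeq_succ] at hx
      by_cases hxn : x < fSeq f n
      · obtain ⟨S, hlt, hS⟩ := ih n (by omega) x hxn
        exact ⟨S, fun i hi => (hlt i hi).trans n.lt_succ_self, hS⟩
      · obtain ⟨S, hlt, hS, hsum⟩ := ih (n - f n) (by omega) (x - fSeq f n) (by omega)
        have hn : n ∉ S := fun h => by have := hlt n h; omega
        refine ⟨insert n S, fun i hi => ?_, fun i hi j hj hji => ?_, ?_⟩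
        · rcases Finset.mem_insert.1 hi with rfl | hi
          · omega
          · have := hlt i hi
            omega
        · rcases Finset.mem_insert.1 hi with hin | hiS <;>
            rcases Finset.mem_insert.1 hj with hjn | hjS
          · omega
          · have := hlt j hjS
            subst hin
            omega
          · have := hlt i hiS
            omega
          · exact hS i hiS j hjS hji
        · rw [Finset.sum_insert hn, hsum]
          omega

/-- Legal sets of indices below `n` are determined by their sums. -/
theorem FLegal.eq_of_sum_eq {f : ℕ → ℕ} (n : ℕ) : ∀ {S T : Finset ℕ}, FLegal f S → FLegal f T →
    (∀ i ∈ S, i < n) → (∀ i ∈ T, i < n) → ∑ i ∈ S, fSeq f i = ∑ i ∈ T, fSeq f i → S = T := by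
  induction n using Nat.strong_induction_on with
  | _ n ih =>
    intro S T hS hT hSlt hTlt hsum
    cases n with
    | zero =>
      ext i
      exact ⟨fun hi => by simpa using hSlt i hi, fun hi => by simpa using hTlt i hi⟩
    | succ n =>
      by_cases hnS : n ∈ S <;> by_cases hnT : n ∈ T
      · rw [← Finset.add_sum_erase S _ hnS, ← Finset.add_sum_erase T _ hnT] at hsum
        have := ih (n - f n) (by omega) (hS.erase n) (hT.erase n)
          (hS.lt_of_mem_erase hSlt hnS) (hT.lt_of_mem_erase hTlt hnT) (by omega)
        rw [← Finset.insert_erase hnS, ← Finset.insert_erase hnT, this]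
      · have := hT.sum_lt n (lt_of_forall_lt_succ_of_notMem hTlt hnT)
        rw [← Finset.add_sum_erase S _ hnS] at hsum
        omega
      · have := hS.sum_lt n (lt_of_forall_lt_succ_of_notMem hSlt hnS)
        rw [← Finset.add_sum_erase T _ hnT] at hsum
        omega
      · exact ih n (by omega) hS hT (lt_of_forall_lt_succ_of_notMem hSlt hnS)
          (lt_of_forall_lt_succ_of_notMem hTlt hnT) hsum

theorem stmt0 (f : ℕ → ℕ) :
    StrictMono (fSeq f) ∧
      ∀ x : ℕ, 0 < x →
        ∃! S : Finset ℕ, FLegal f S ∧ ∑ i ∈ S, fSeq f i = x := by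
  refine ⟨fSeq_strictMono f, fun x _ => ?_⟩
  obtain ⟨S, -, hS, hsum⟩ :=
    exists_fLegal_sum_eq f (x + 1) x ((fSeq_strictMono f).le_apply (x := x + 1))
  refine ⟨S, ⟨hS, hsum⟩, fun T ⟨hT, hTsum⟩ => ?_⟩
  exact hT.eq_of_sum_eq ((S ∪ T).sup id + 1) hS
    (fun i hi => Nat.lt_succ_of_le (Finset.le_sup (f := id) (Finset.mem_union_right S hi)))
    (fun i hi => Nat.lt_succ_of_le (Finset.le_sup (f := id) (Finset.mem_union_left T hi)))
    (hTsum.trans hsum.symm)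
end

section
/- Let f : ℕ → ℕ be any function and let a : ℕ → ℕ be the associated f-sequence. If a' : ℕ → ℕ is any strictly increasing sequence of positive integers such that every positive integer has exactly one f-decomposition using a', then a' = a. -/
theorem fSeq_zero (f : ℕ → ℕ) : fSeq f 0 = 1 := by
  rw [fSeq]

theorem FLegal.mono {f : ℕ → ℕ} {S T : Finset ℕ} (hT : FLegal f T) (h : S ⊆ T) :
    FLegal f S :=
  fun i hi j hj => hT i (h hi) j (h hj)

theorem fLegal_singleton (f : ℕ → ℕ) (n : ℕ) : FLegal f {n} := by
  intro i hi j hj hij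
  simp only [Finset.mem_singleton] at hi hj
  omega

/-- Legal sums of terms with indices below `m` are less than the `m`-th term. -/
theorem FLegal.sum_fSeq_lt {f : ℕ → ℕ} (m : ℕ) {S : Finset ℕ} (hS : FLegal f S)
    (hm : ∀ i ∈ S, i < m) : ∑ i ∈ S, fSeq f i < fSeq f m := by
  induction m using Nat.strong_induction_on generalizing S with
  | _ m ih =>
    cases m with
    | zero =>
      have hempty : S = ∅ := Finset.eq_empty_of_forall_notMem fun i hi => by
        have := hm i hi
        omega
      simp [hempty, fSeq_zero]
    | succ n =>
      rw [fSeq_succ]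
      by_cases hn : n ∈ S
      · rw [← Finset.add_sum_erase S _ hn]
        refine Nat.add_lt_add_left
          (ih _ (by omega) (hS.mono (Finset.erase_subset n S)) fun j hj => ?_) _
        obtain ⟨hjn, hjS⟩ := Finset.mem_erase.mp hj
        have hlt := hm j hjS
        have := hS n hn j hjS (by omega)
        omega
      · refine Nat.lt_add_right _ (ih n (by omega) hS fun j hj => ?_)
        have hlt := hm j hj
        have : j ≠ n := fun h => hn (h ▸ hj)
        omega

/-- Every number less than the `m`-th term is a legal sum of terms with indices below `m`. -/
theorem exists_fLegal_sum_fSeq_eq (f : ℕ → ℕ) (m x : ℕ) (hx : x < fSeq f m) :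
    ∃ S : Finset ℕ, FLegal f S ∧ (∀ i ∈ S, i < m) ∧ ∑ i ∈ S, fSeq f i = x := by
  induction m using Nat.strong_induction_on generalizing x with
  | _ m ih =>
    cases m with
    | zero =>
      rw [fSeq_zero] at hx
      exact ⟨∅, by simp [FLegal], by simp, by simp; omega⟩
    | succ n =>
      rw [fSeq_succ] at hx
      rcases lt_or_ge x (fSeq f n) with h | h
      · obtain ⟨S, hS, hlt, hsum⟩ := ih n (by omega) x h
        exact ⟨S, hS, fun i hi => (hlt i hi).trans (by omega), hsum⟩
      · obtain ⟨S, hS, hlt, hsum⟩ := ih (n - f n) (by omega) (x - fSeq f n) (by omega)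
        have hn : n ∉ S := fun hn => by
          have := hlt n hn
          omega
        refine ⟨insert n S, ?_, ?_, ?_⟩
        · intro i hi j hj hij
          rcases Finset.mem_insert.mp hi with hin | hiS <;>
            rcases Finset.mem_insert.mp hj with hjn | hjS
          · omega
          · subst hin
            have := hlt j hjS
            omega
          · have := hlt i hiS
            omega
          · exact hS i hiS j hjS hij
        · intro i hi
          rcases Finset.mem_insert.mp hi with rfl | hi
          · omega
          · have := hlt i hi
            omega
        · rw [Finset.sum_insert hn, hsum]
          omega

theorem stmt1 (f : ℕ → ℕ) (a' : ℕ → ℕ) (hmono : StrictMono a') (hpos : ∀ n, 0 < a' n)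
    (huniq : ∀ x : ℕ, 0 < x →
      ∃! S : Finset ℕ, FLegal f S ∧ ∑ i ∈ S, a' i = x) :
    a' = fSeq f := by
  funext n
  induction n using Nat.strong_induction_on with
  | _ n ih =>
    have hsum_eq : ∀ S : Finset ℕ, (∀ i ∈ S, i < n) →
        ∑ i ∈ S, a' i = ∑ i ∈ S, fSeq f i :=
      fun S hS => Finset.sum_congr rfl fun i hi => ih i (hS i hi)
    rcases lt_trichotomy (a' n) (fSeq f n) with h | h | h
    · obtain ⟨S, hS, hlt, hsum⟩ := exists_fLegal_sum_fSeq_eq f n _ h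
      have hSn : S = {n} := (huniq (a' n) (hpos n)).unique
        ⟨hS, (hsum_eq S hlt).trans hsum⟩ ⟨fLegal_singleton f n, by simp⟩
      exact absurd (hlt n (by simp [hSn])) (lt_irrefl n)
    · exact h
    · have hfpos : 0 < fSeq f n :=
        Nat.zero_lt_of_lt (FLegal.sum_fSeq_lt (S := ∅) n (by simp [FLegal]) (by simp))
      obtain ⟨S, hS, hsum⟩ := (huniq _ hfpos).exists
      have hlt : ∀ i ∈ S, i < n := fun i hi => hmono.lt_iff_lt.mp <|
        (Finset.single_le_sum (fun j _ => Nat.zero_le (a' j)) hi).trans_lt (hsum.trans_lt h)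
      exact absurd ((hsum_eq S hlt).symm.trans hsum) (hS.sum_fSeq_lt n hlt).ne
end

section
/- Let f : ℕ → ℕ be periodic, i.e., there exists p ≥ 1 with f(n + p) = f(n) for all n ∈ ℕ, and let a : ℕ → ℕ be the associated f-sequence. Then a satisfies a linear homogeneous recurrence relation with constant integer coefficients: there exist k ≥ 1, integers c_1, …, c_k with c_k ≠ 0, and N ∈ ℕ such that a(n) = ∑_{i=1}^{k} c_i · a(n − i) for all n ≥ N. -/
/-- The shift operator on integer sequences. -/
def seqShift : (ℕ → ℤ) →ₗ[ℤ] (ℕ → ℤ) := LinearMap.funLeft ℤ ℤ Nat.succ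

theorem seqShift_apply (b : ℕ → ℤ) (n : ℕ) : seqShift b n = b (n + 1) := rfl

/-- A sequence lying in a finitely generated shift-stable module of integer sequences is
annihilated by a monic polynomial in the shift. -/
theorem exists_monic_sum_coeff_mul_eq_zero (W : Submodule ℤ (ℕ → ℤ)) (hfg : W.FG)
    (hW : ∀ w ∈ W, seqShift w ∈ W) (b : ℕ → ℤ) (hb : b ∈ W) :
    ∃ P : Polynomial ℤ, P.Monic ∧
      ∀ n, ∑ i ∈ Finset.range (P.natDegree + 1), P.coeff i * b (n + i) = 0 := by
  have : Module.Finite ℤ W := Module.Finite.iff_fg.mpr hfg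
  obtain ⟨P, hP, h0⟩ := LinearMap.exists_monic_and_aeval_eq_zero ℤ (seqShift.restrict hW)
  have hpow : ∀ i n, (((seqShift.restrict hW) ^ i) ⟨b, hb⟩ : W).1 n = b (n + i) := by
    intro i
    induction i with
    | zero => simp
    | succ i ih =>
      intro n
      rw [pow_succ', Module.End.mul_apply, LinearMap.coe_restrict_apply, seqShift_apply, ih]
      congr 1
      omega
  refine ⟨P, hP, fun n => ?_⟩
  have h1 := congrArg (fun w : W => w.1 n) (LinearMap.congr_fun h0 ⟨b, hb⟩)
  rw [Polynomial.aeval_eq_sum_range] at h1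
  simpa [LinearMap.sum_apply, hpow] using h1

/-- The sequence `n ↦ fSeq f (n + F - j)` restricted to the residue class `r` modulo `p`. -/
def fSeqClass (f : ℕ → ℕ) (p F : ℕ) (x : ZMod p × Fin (F + 1)) (n : ℕ) : ℤ :=
  if (n : ZMod p) = x.1 then (fSeq f (n + F - x.2) : ℤ) else 0

theorem seqShift_fSeqClass_mem (f : ℕ → ℕ) (p F : ℕ) (hper : ∀ n, f (n + p) = f n)
    (hF : ∀ n, f n ≤ F) (x : ZMod p × Fin (F + 1)) :
    seqShift (fSeqClass f p F x) ∈ Submodule.span ℤ (Set.range (fSeqClass f p F)) := by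
  obtain ⟨r, j, hj⟩ := x
  have hmem : ∀ x, fSeqClass f p F x ∈ Submodule.span ℤ (Set.range (fSeqClass f p F)) :=
    fun x => Submodule.subset_span ⟨x, rfl⟩
  have hr : ∀ n : ℕ, ((n + 1 : ℕ) : ZMod p) = r ↔ (n : ZMod p) = r - 1 := by
    intro n
    rw [eq_sub_iff_add_eq]
    push_cast
    rfl
  rcases j with _ | j
  · have key : seqShift (fSeqClass f p F (r, ⟨0, hj⟩)) = fSeqClass f p F (r - 1, ⟨0, hj⟩) +
        fSeqClass f p F (r - 1,
          ⟨f ((r - 1 + (F : ZMod p)).val), Nat.lt_succ_of_le (hF _)⟩) := by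
      funext n
      rw [seqShift_apply, Pi.add_apply]
      simp only [fSeqClass, hr]
      split_ifs with h
      · have hval : f ((r - 1 + (F : ZMod p)).val) = f (n + F) := by
          rw [← h, ← Nat.cast_add, ZMod.val_natCast]
          exact Function.Periodic.map_mod_nat hper _
        have hle := hF (n + F)
        rw [hval, Nat.sub_zero, Nat.sub_zero, show n + 1 + F = n + F + 1 by omega, fSeq,
          if_pos (by omega)]
        push_cast
        rfl
      · rfl
    rw [key]
    exact add_mem (hmem _) (hmem _)
  · have key : seqShift (fSeqClass f p F (r, ⟨j + 1, hj⟩)) =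
        fSeqClass f p F (r - 1, ⟨j, by omega⟩) := by
      funext n
      rw [seqShift_apply]
      simp only [fSeqClass, hr]
      rw [show n + 1 + F - (j + 1) = n + F - j by omega]
    rw [key]
    exact hmem _

theorem fSeq_add_mem_span (f : ℕ → ℕ) (p F : ℕ) [NeZero p] :
    (fun n => (fSeq f (n + F) : ℤ)) ∈ Submodule.span ℤ (Set.range (fSeqClass f p F)) := by
  have key : (fun n => (fSeq f (n + F) : ℤ)) = ∑ r : ZMod p, fSeqClass f p F (r, 0) := by
    funext n
    simp [fSeqClass]
  rw [key]
  exact sum_mem fun r _ => Submodule.subset_span ⟨_, rfl⟩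

theorem exists_monic_fSeq (f : ℕ → ℕ) (p : ℕ) (hp : 1 ≤ p) (hper : ∀ n, f (n + p) = f n) :
    ∃ (P : Polynomial ℤ) (F : ℕ), P.Monic ∧
      ∀ n, ∑ i ∈ Finset.range (P.natDegree + 1), P.coeff i * (fSeq f (n + i + F) : ℤ) = 0 := by
  have : NeZero p := ⟨by omega⟩
  obtain ⟨F, hF⟩ : ∃ F, ∀ n, f n ≤ F := by
    refine ⟨(Finset.range p).sup f, fun n => ?_⟩
    rw [← Function.Periodic.map_mod_nat hper n]
    exact Finset.le_sup (Finset.mem_range.mpr (Nat.mod_lt _ hp))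
  obtain ⟨P, hP, h⟩ := exists_monic_sum_coeff_mul_eq_zero
    (Submodule.span ℤ (Set.range (fSeqClass f p F)))
    (Submodule.fg_span (Set.finite_range _))
    (fun w hw => (Submodule.span_le.mpr (by
      rintro _ ⟨x, rfl⟩
      exact seqShift_fSeqClass_mem f p F hper hF x) :
        Submodule.span ℤ (Set.range (fSeqClass f p F)) ≤
          (Submodule.span ℤ (Set.range (fSeqClass f p F))).comap seqShift) hw)
    _ (fSeq_add_mem_span f p F)
  exact ⟨P, F, hP, h⟩

theorem stmt2 (f : ℕ → ℕ) (p : ℕ) (hp : 1 ≤ p) (hper : ∀ n, f (n + p) = f n) :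
    ∃ (k : ℕ) (c : ℕ → ℤ) (N : ℕ), 1 ≤ k ∧ c k ≠ 0 ∧ k ≤ N ∧
      ∀ n, N ≤ n → (fSeq f n : ℤ) = ∑ i ∈ Finset.Icc 1 k, c i * (fSeq f (n - i) : ℤ) := by
  obtain ⟨P, F, hP, h⟩ := exists_monic_fSeq f p hp hper
  have hm : P.natTrailingDegree ≤ P.natDegree := P.natTrailingDegree_le_natDegree
  have hrec : ∀ n, P.natDegree + F ≤ n → (fSeq f n : ℤ) =
      ∑ i ∈ Finset.Icc 1 (P.natDegree - P.natTrailingDegree),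
        -P.coeff (P.natDegree - i) * (fSeq f (n - i) : ℤ) := by
    intro n hn
    have h1 := h (n - P.natDegree - F)
    rw [Finset.sum_range_succ, hP.coeff_natDegree, one_mul,
      show n - P.natDegree - F + P.natDegree + F = n by omega, ← Finset.sum_range_reflect] at h1
    have h2 : ∑ i ∈ Finset.Icc 1 (P.natDegree - P.natTrailingDegree),
        P.coeff (P.natDegree - i) * (fSeq f (n - i) : ℤ) =
        ∑ i ∈ Finset.range P.natDegree, P.coeff (P.natDegree - 1 - i) *
          (fSeq f (n - P.natDegree - F + (P.natDegree - 1 - i) + F) : ℤ) := by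
      rw [← Finset.sum_subset (Finset.range_mono (Nat.sub_le _ P.natTrailingDegree)),
        ← Finset.Ico_add_one_right_eq_Icc, Finset.sum_Ico_eq_sum_range]
      · refine Finset.sum_congr (by simp) fun i hi => ?_
        rw [Finset.mem_range] at hi
        rw [show P.natDegree - (1 + i) = P.natDegree - 1 - i by omega,
          show n - (1 + i) = n - P.natDegree - F + (P.natDegree - 1 - i) + F by omega]
      · intro i hi hi'
        rw [Finset.mem_range] at hi hi'
        rw [Polynomial.coeff_eq_zero_of_lt_natTrailingDegree (by omega), zero_mul]
    simp only [neg_mul, Finset.sum_neg_distrib]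
    linarith
  refine ⟨P.natDegree - P.natTrailingDegree, fun i => -P.coeff (P.natDegree - i),
    P.natDegree + F, ?_, ?_, by omega, hrec⟩
  · by_contra hk
    have h1 := hrec _ le_rfl
    rw [Finset.Icc_eq_empty hk, Finset.sum_empty] at h1
    have := fSeq_pos f (P.natDegree + F)
    omega
  · beta_reduce
    rw [Nat.sub_sub_self hm, neg_ne_zero]
    exact Polynomial.trailingCoeff_nonzero_iff_nonzero.mpr hP.ne_zero
end

section
/- For each n ≥ 1, let m be chosen uniformly at random from {0, 1, …, (n+1)! − 1}, and let X_n(m) = #{i ∈ {1, …, n} : d_i(m) ≠ 0}, where d_i(m) = ⌊m / i!⌋ mod (i+1) is the i-th digit of m in the factorial number system (so that m = ∑_{i=1}^{n} d_i(m) · i! with 0 ≤ d_i(m) ≤ i). Let μ_n and σ_n be the mean and standard deviation of X_n. Then the normalized random variables (X_n − μ_n)/σ_n converge in distribution, as n → ∞, to the standard normal distribution N(0,1). -/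
open Finset

/-- Number of nonzero digits in the factorial number system representation of `m`,
using digits `d_i(m) = ⌊m / i!⌋ mod (i+1)` for `i = 1, …, n`. -/
def factorialSummands (n m : ℕ) : ℕ :=
  ((Finset.Icc 1 n).filter (fun i => (m / Nat.factorial i) % (i + 1) ≠ 0)).card

open MeasureTheory ProbabilityTheory Filter Topology

/-- Adding a multiple of `(n+1)!` with multiplier `q ≤ n + 1` puts `q` in digit position `n + 1`
and leaves the lower digits unchanged. -/
lemma factorialSummands_succ_add {n q r : ℕ} (hq : q < n + 2) (hr : r < (n + 1).factorial) :
    factorialSummands (n + 1) (r + (n + 1).factorial * q) =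
      factorialSummands n r + if q = 0 then 0 else 1 := by
  unfold factorialSummands
  have hlow : ∀ i ∈ Icc 1 n, ((r + (n + 1).factorial * q) / i.factorial % (i + 1) ≠ 0 ↔
      r / i.factorial % (i + 1) ≠ 0) := by
    intro i hi
    obtain ⟨c, hc⟩ : (i + 1).factorial ∣ (n + 1).factorial :=
      Nat.factorial_dvd_factorial (by have := (mem_Icc.1 hi).2; omega)
    have e : (n + 1).factorial * q = i.factorial * ((i + 1) * (c * q)) := by
      rw [hc, Nat.factorial_succ]; ring
    rw [e, Nat.add_mul_div_left _ _ i.factorial_pos, Nat.add_mul_mod_self_left]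
  have htop : (r + (n + 1).factorial * q) / (n + 1).factorial % (n + 1 + 1) = q := by
    rw [Nat.add_mul_div_left _ _ (n + 1).factorial_pos, Nat.div_eq_of_lt hr, zero_add,
      Nat.mod_eq_of_lt hq]
  rw [← Finset.insert_Icc_right_eq_Icc_add_one (by omega), filter_insert, filter_congr hlow, htop]
  split_ifs <;> simp_all

lemma sum_range_mul_eq_sum_sum {E : Type*} [AddCommMonoid E] (K N : ℕ) (f : ℕ → E) :
    ∑ m ∈ range (K * N), f m = ∑ r ∈ range N, ∑ q ∈ range K, f (r + N * q) := by
  induction K with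
  | zero => simp
  | succ K ih =>
    simp_rw [add_one_mul, sum_range_succ, sum_add_distrib]
    rw [sum_range_add, ih]
    simp_rw [mul_comm K N, add_comm (N * K)]

lemma sum_factorialSummands_succ {E : Type*} [AddCommMonoid E] (n : ℕ) (f : ℕ → E) :
    ∑ m ∈ range (n + 2).factorial, f (factorialSummands (n + 1) m) =
      ∑ r ∈ range (n + 1).factorial,
        (f (factorialSummands n r) + (n + 1) • f (factorialSummands n r + 1)) := by
  rw [Nat.factorial_succ (n + 1), sum_range_mul_eq_sum_sum]
  refine sum_congr rfl fun r hr => ?_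
  rw [sum_congr rfl fun q hq =>
    by rw [factorialSummands_succ_add (mem_range.1 hq) (mem_range.1 hr)], sum_range_succ']
  simp [add_comm]

/-- The mean of the number of nonzero digits. -/
noncomputable def digitMean (n : ℕ) : ℝ := ∑ i ∈ range n, ((i : ℝ) + 1) / (i + 2)

/-- The variance of the number of nonzero digits. -/
noncomputable def digitVariance (n : ℕ) : ℝ := ∑ i ∈ range n, ((i : ℝ) + 1) / (i + 2) ^ 2

lemma factorialSummands_zero (m : ℕ) : factorialSummands 0 m = 0 := by
  simp [factorialSummands]

lemma factorial_add_two_cast (n : ℕ) :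
    ((n + 2).factorial : ℝ) = (n + 2) * (n + 1).factorial := by
  rw [Nat.factorial_succ (n + 1)]; push_cast; ring

lemma sum_factorialSummands (n : ℕ) :
    ∑ m ∈ range (n + 1).factorial, (factorialSummands n m : ℝ) =
      (n + 1).factorial * digitMean n := by
  induction n with
  | zero => simp [factorialSummands_zero, digitMean]
  | succ n ih =>
    rw [sum_factorialSummands_succ n (fun k => (k : ℝ)), factorial_add_two_cast, digitMean,
      sum_range_succ, ← digitMean]
    have e : ∀ r, ((factorialSummands n r : ℝ) +
        (n + 1) • ((factorialSummands n r + 1 : ℕ) : ℝ)) =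
        (n + 2) * factorialSummands n r + (n + 1) := by
      intro r; simp only [nsmul_eq_mul]; push_cast; ring
    simp_rw [e]
    rw [sum_add_distrib, ← mul_sum, ih]
    simp only [sum_const, card_range, nsmul_eq_mul]
    field_simp

lemma sum_factorialSummands_sub_sq (n : ℕ) :
    ∑ m ∈ range (n + 1).factorial, ((factorialSummands n m : ℝ) - digitMean n) ^ 2 =
      (n + 1).factorial * digitVariance n := by
  induction n with
  | zero => simp [factorialSummands_zero, digitMean, digitVariance]
  | succ n ih =>
    rw [sum_factorialSummands_succ n (fun k => ((k : ℝ) - digitMean (n + 1)) ^ 2),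
      factorial_add_two_cast, digitVariance, sum_range_succ, ← digitVariance]
    have e : ∀ r, ((factorialSummands n r : ℝ) - digitMean (n + 1)) ^ 2 +
        (n + 1) • (((factorialSummands n r + 1 : ℕ) : ℝ) - digitMean (n + 1)) ^ 2 =
        (n + 2) * ((factorialSummands n r : ℝ) - digitMean n) ^ 2 + (n + 1) / (n + 2) := by
      intro r
      rw [digitMean, sum_range_succ, ← digitMean]
      simp only [nsmul_eq_mul]; push_cast
      field_simp
      ring
    simp_rw [e]
    rw [sum_add_distrib, ← mul_sum, ih]
    simp only [sum_const, card_range, nsmul_eq_mul]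
    field_simp

/-- The characteristic function of a centred Bernoulli variable of parameter `p`. -/
noncomputable def centeredBernoulliCharFun (p s : ℝ) : ℂ :=
  p * Complex.exp (((s * (1 - p) : ℝ) : ℂ) * Complex.I) +
    (1 - p : ℝ) * Complex.exp (((-(s * p) : ℝ) : ℂ) * Complex.I)

lemma norm_centeredBernoulliCharFun_le {p : ℝ} (hp : 0 ≤ p) (hp' : p ≤ 1) (s : ℝ) :
    ‖centeredBernoulliCharFun p s‖ ≤ 1 := by
  refine (norm_add_le _ _).trans ?_
  rw [norm_mul, norm_mul, Complex.norm_exp_ofReal_mul_I, Complex.norm_exp_ofReal_mul_I,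
    Complex.norm_real, Complex.norm_real, Real.norm_of_nonneg hp,
    Real.norm_of_nonneg (by linarith)]
  linarith

lemma norm_exp_mul_I_sub_quadratic_le {x : ℝ} (hx : |x| ≤ 1) :
    ‖Complex.exp (x * Complex.I) - (1 + x * Complex.I - x ^ 2 / 2)‖ ≤ 3 * |x| ^ 3 := by
  have h := Complex.norm_exp_sub_sum_le_norm_mul_exp (x * Complex.I) 3
  have hn : ‖(x : ℂ) * Complex.I‖ = |x| := by simp
  rw [hn] at h
  have e : ∑ m ∈ range 3, ((x : ℂ) * Complex.I) ^ m / (m.factorial : ℂ) =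
      1 + x * Complex.I - x ^ 2 / 2 := by
    simp [sum_range_succ, mul_pow, Nat.factorial]
    ring
  rw [e] at h
  have h3 : Real.exp |x| ≤ 3 :=
    (Real.exp_le_exp.2 hx).trans (by linarith [Real.exp_one_lt_d9])
  refine h.trans ?_
  rw [mul_comm]
  gcongr

lemma norm_centeredBernoulliCharFun_sub_le {p s : ℝ} (hp : 0 ≤ p) (hp' : p ≤ 1) (hs : |s| ≤ 1) :
    ‖centeredBernoulliCharFun p s - Real.exp (-(s ^ 2 * (p * (1 - p)) / 2))‖ ≤
      4 * |s| ^ 3 * (p * (1 - p)) := by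
  have hq : 0 ≤ 1 - p := by linarith
  have hq' : 1 - p ≤ 1 := by linarith
  have hv : 0 ≤ p * (1 - p) := mul_nonneg hp hq
  have hv' : p * (1 - p) ≤ 1 := mul_le_one₀ hp' hq hq'
  have hs0 : 0 ≤ |s| := abs_nonneg s
  have a1 : |s * (1 - p)| = |s| * (1 - p) := by rw [abs_mul, abs_of_nonneg hq]
  have a2 : |-(s * p)| = |s| * p := by rw [abs_neg, abs_mul, abs_of_nonneg hp]
  have h1 := norm_exp_mul_I_sub_quadratic_le (x := s * (1 - p))
    (by rw [a1]; exact mul_le_one₀ hs hq hq')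
  have h2 := norm_exp_mul_I_sub_quadratic_le (x := -(s * p))
    (by rw [a2]; exact mul_le_one₀ hs hp hp')
  rw [a1] at h1
  rw [a2] at h2
  set x : ℝ := -(s ^ 2 * (p * (1 - p)) / 2) with hx
  have hs2 : s ^ 2 = |s| ^ 2 := (sq_abs s).symm
  have hs2' : s ^ 2 ≤ 1 := by rw [hs2]; exact pow_le_one₀ hs0 hs
  have hx2 : |x| = s ^ 2 * (p * (1 - p)) / 2 := by
    rw [hx, abs_neg, abs_of_nonneg (by positivity)]
  have h3 : ‖Real.exp x - 1 - x‖ ≤ ‖x‖ ^ 2 := Real.norm_exp_sub_one_sub_id_le (by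
    rw [Real.norm_eq_abs, hx2]
    have := mul_le_one₀ hs2' hv hv'
    linarith)
  rw [Real.norm_eq_abs x, hx2] at h3
  have key : centeredBernoulliCharFun p s - Real.exp x =
      p * (Complex.exp (((s * (1 - p) : ℝ) : ℂ) * Complex.I) -
        (1 + ((s * (1 - p) : ℝ) : ℂ) * Complex.I - ((s * (1 - p) : ℝ) : ℂ) ^ 2 / 2)) +
      (1 - p : ℝ) * (Complex.exp (((-(s * p) : ℝ) : ℂ) * Complex.I) -
        (1 + ((-(s * p) : ℝ) : ℂ) * Complex.I - ((-(s * p) : ℝ) : ℂ) ^ 2 / 2)) -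
      ((Real.exp x - 1 - x : ℝ) : ℂ) := by
    rw [centeredBernoulliCharFun, hx]
    push_cast
    ring
  rw [key]
  refine (norm_sub_le _ _).trans ((add_le_add (norm_add_le _ _) le_rfl).trans ?_)
  rw [norm_mul, norm_mul, Complex.norm_real, Complex.norm_real, Complex.norm_real,
    Real.norm_of_nonneg hp, Real.norm_of_nonneg hq]
  have b1 : p * (3 * (|s| * (1 - p)) ^ 3) + (1 - p) * (3 * (|s| * p) ^ 3) ≤
      3 * |s| ^ 3 * (p * (1 - p)) := by
    have : p * (3 * (|s| * (1 - p)) ^ 3) + (1 - p) * (3 * (|s| * p) ^ 3) =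
      3 * |s| ^ 3 * (p * (1 - p)) * (1 - 2 * (p * (1 - p))) := by ring
    rw [this]
    exact mul_le_of_le_one_right (by positivity) (by linarith)
  have b2 : (s ^ 2 * (p * (1 - p)) / 2) ^ 2 ≤ |s| ^ 3 * (p * (1 - p)) := by
    have : (s ^ 2 * (p * (1 - p)) / 2) ^ 2 =
      |s| ^ 3 * (p * (1 - p)) * (|s| * (p * (1 - p)) / 4) := by rw [hs2]; ring
    rw [this]
    have := mul_le_one₀ hs hv hv'
    exact mul_le_of_le_one_right (by positivity) (by linarith)
  have c1 := mul_le_mul_of_nonneg_left h1 hp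
  have c2 := mul_le_mul_of_nonneg_left h2 hq
  linarith

/-- The characteristic function of the centred number of nonzero digits. -/
noncomputable def digitCharFun (n : ℕ) (s : ℝ) : ℂ :=
  (∑ m ∈ range (n + 1).factorial,
    Complex.exp (((s * ((factorialSummands n m : ℝ) - digitMean n) : ℝ) : ℂ) * Complex.I)) /
      ((n + 1).factorial : ℂ)

lemma digitCharFun_succ (n : ℕ) (s : ℝ) :
    digitCharFun (n + 1) s =
      digitCharFun n s * centeredBernoulliCharFun (((n : ℝ) + 1) / (n + 2)) s := by
  set p : ℝ := ((n : ℝ) + 1) / (n + 2) with hp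
  have hp1 : (((n : ℝ) + 2) * p) = n + 1 := by rw [hp]; field_simp
  have hp2 : (((n : ℝ) + 2) * (1 - p)) = 1 := by rw [mul_sub, hp1]; ring
  have hp1' : (((n : ℂ) + 2) * p) = n + 1 := by exact_mod_cast hp1
  have hp2' : (((n : ℂ) + 2) * (1 - p : ℝ)) = 1 := by exact_mod_cast hp2
  have hmean : digitMean (n + 1) = digitMean n + p := by
    rw [digitMean, sum_range_succ, ← digitMean]
  have hfac : ((n + 2).factorial : ℂ) = (n + 2) * (n + 1).factorial := by
    exact_mod_cast factorial_add_two_cast n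
  have hn : ((n : ℂ) + 2) ≠ 0 := by exact_mod_cast (by positivity : (n : ℝ) + 2 ≠ 0)
  rw [digitCharFun, digitCharFun, sum_factorialSummands_succ n (fun k =>
    Complex.exp (((s * ((k : ℝ) - digitMean (n + 1)) : ℝ) : ℂ) * Complex.I)), hfac, hmean]
  have e : ∀ r, Complex.exp (((s * ((factorialSummands n r : ℝ) - (digitMean n + p)) : ℝ) : ℂ) *
        Complex.I) +
      (n + 1) • Complex.exp (((s * (((factorialSummands n r + 1 : ℕ) : ℝ) -
        (digitMean n + p)) : ℝ) : ℂ) * Complex.I) =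
      Complex.exp (((s * ((factorialSummands n r : ℝ) - digitMean n) : ℝ) : ℂ) * Complex.I) *
        ((n + 2) * centeredBernoulliCharFun p s) := by
    intro r
    rw [centeredBernoulliCharFun, mul_add ((n : ℂ) + 2), ← mul_assoc ((n : ℂ) + 2), hp1',
      ← mul_assoc ((n : ℂ) + 2), hp2', one_mul, mul_add, mul_left_comm, ← Complex.exp_add,
      ← Complex.exp_add, add_comm, nsmul_eq_mul]
    push_cast
    congr 3
    all_goals ring_nf
  simp_rw [e]
  rw [← sum_mul, ← mul_assoc, mul_comm _ ((n : ℂ) + 2), mul_assoc, mul_div_mul_left _ _ hn,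
    div_mul_eq_mul_div]

lemma digitVariance_nonneg (n : ℕ) : 0 ≤ digitVariance n :=
  sum_nonneg fun _ _ => by positivity

lemma norm_digitCharFun_sub_le (n : ℕ) {s : ℝ} (hs : |s| ≤ 1) :
    ‖digitCharFun n s - Real.exp (-(s ^ 2 * digitVariance n / 2))‖ ≤
      4 * |s| ^ 3 * digitVariance n := by
  induction n with
  | zero => simp [digitCharFun, digitVariance, factorialSummands_zero, digitMean]
  | succ n ih =>
    have hp : 0 ≤ ((n : ℝ) + 1) / (n + 2) := by positivity
    have hp' : ((n : ℝ) + 1) / (n + 2) ≤ 1 := by rw [div_le_one (by positivity)]; linarith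
    have hv : ((n : ℝ) + 1) / (n + 2) * (1 - ((n : ℝ) + 1) / (n + 2)) =
        ((n : ℝ) + 1) / (n + 2) ^ 2 := by field_simp; ring
    have hb := norm_centeredBernoulliCharFun_sub_le hp hp' hs
    have ha := norm_centeredBernoulliCharFun_le hp hp' s
    rw [hv] at hb
    rw [digitCharFun_succ]
    have hV : digitVariance (n + 1) = digitVariance n + ((n : ℝ) + 1) / (n + 2) ^ 2 := by
      rw [digitVariance, sum_range_succ, ← digitVariance]
    set v : ℝ := ((n : ℝ) + 1) / (n + 2) ^ 2
    set a := centeredBernoulliCharFun (((n : ℝ) + 1) / (n + 2)) s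
    have hB : ‖(Real.exp (-(s ^ 2 * digitVariance n / 2)) : ℂ)‖ ≤ 1 := by
      rw [Complex.norm_real, Real.norm_of_nonneg (Real.exp_pos _).le, Real.exp_le_one_iff]
      have := digitVariance_nonneg n
      have : 0 ≤ s ^ 2 * digitVariance n / 2 := by positivity
      linarith
    have hexp : Real.exp (-(s ^ 2 * digitVariance (n + 1) / 2)) =
        Real.exp (-(s ^ 2 * digitVariance n / 2)) * Real.exp (-(s ^ 2 * v / 2)) := by
      rw [← Real.exp_add, hV]; ring_nf
    have key : digitCharFun n s * a - Real.exp (-(s ^ 2 * digitVariance (n + 1) / 2)) =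
        (digitCharFun n s - Real.exp (-(s ^ 2 * digitVariance n / 2))) * a +
        Real.exp (-(s ^ 2 * digitVariance n / 2)) * (a - Real.exp (-(s ^ 2 * v / 2))) := by
      rw [hexp]; push_cast; ring
    rw [key, hV, mul_add]
    refine (norm_add_le _ _).trans (add_le_add ?_ ?_)
    · rw [norm_mul]
      exact (mul_le_of_le_one_right (norm_nonneg _) ha).trans ih
    · rw [norm_mul]
      exact (mul_le_of_le_one_left (norm_nonneg _) hB).trans hb

lemma tendsto_digitVariance_atTop : Tendsto digitVariance atTop atTop := by
  refine tendsto_atTop_mono (fun n => ?_)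
    (Real.tendsto_sum_range_one_div_nat_succ_atTop.const_mul_atTop (by norm_num : (0 : ℝ) < 1 / 4))
  rw [mul_sum]
  refine sum_le_sum fun i _ => ?_
  rw [div_mul_div_comm, div_le_div_iff₀ (by positivity) (by positivity)]
  have : (0 : ℝ) ≤ i := i.cast_nonneg
  nlinarith

lemma tendsto_digitCharFun_div_sqrt (t : ℝ) :
    Tendsto (fun n => digitCharFun n (t / √(digitVariance n))) atTop
      (𝓝 (Complex.exp (-(t : ℂ) ^ 2 / 2))) := by
  have hsqrt : Tendsto (fun n => √(digitVariance n)) atTop atTop :=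
    Real.tendsto_sqrt_atTop.comp tendsto_digitVariance_atTop
  have hs : Tendsto (fun n => |t| / √(digitVariance n)) atTop (𝓝 0) :=
    hsqrt.const_div_atTop _
  have hbound : Tendsto (fun n => 4 * |t| ^ 2 * (|t| / √(digitVariance n))) atTop (𝓝 0) := by
    simpa only [mul_zero] using hs.const_mul (4 * |t| ^ 2)
  rw [tendsto_iff_norm_sub_tendsto_zero]
  refine squeeze_zero' (Eventually.of_forall fun _ => norm_nonneg _) ?_ hbound
  filter_upwards [hs.eventually_le_const zero_lt_one,
    tendsto_digitVariance_atTop.eventually_gt_atTop 0] with n hn hpos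
  have h0 : 0 < √(digitVariance n) := Real.sqrt_pos.2 hpos
  have habs : |t / √(digitVariance n)| = |t| / √(digitVariance n) := by
    rw [abs_div, abs_of_pos h0]
  have h := norm_digitCharFun_sub_le n (s := t / √(digitVariance n)) (by rwa [habs])
  have e1 : (t / √(digitVariance n)) ^ 2 * digitVariance n = t ^ 2 := by
    rw [div_pow, Real.sq_sqrt hpos.le]; field_simp
  have e2 : 4 * |t / √(digitVariance n)| ^ 3 * digitVariance n =
      4 * |t| ^ 2 * (|t| / √(digitVariance n)) := by
    have := Real.sq_sqrt hpos.le
    rw [habs]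
    nth_rewrite 2 [← this]
    field_simp
  rw [e1, e2] at h
  simpa [neg_div] using h

/-- Lévy's continuity theorem for empirical averages of finite families of reals, with standard
Gaussian limit. -/
lemma tendsto_average_of_tendsto_charFun {N : ℕ → ℕ} (hN : ∀ n, N n ≠ 0) {Y : ℕ → ℕ → ℝ}
    (h : ∀ t : ℝ, Tendsto
      (fun n => (∑ m ∈ range (N n), Complex.exp (((t * Y n m : ℝ) : ℂ) * Complex.I)) / (N n : ℂ))
      atTop (𝓝 (Complex.exp (-(t : ℂ) ^ 2 / 2))))
    (g : BoundedContinuousFunction ℝ ℝ) :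
    Tendsto (fun n => (∑ m ∈ range (N n), g (Y n m)) / (N n : ℝ)) atTop
      (𝓝 (∫ x, g x ∂(gaussianReal 0 1))) := by
  let ν : ℕ → Measure ℝ := fun n =>
    (N n : ENNReal)⁻¹ • ∑ m ∈ range (N n), Measure.dirac (Y n m)
  have hν : ∀ n, IsProbabilityMeasure (ν n) := fun n => ⟨by
    simp only [ν, Measure.smul_apply, Measure.finsetSum_apply, measure_univ, sum_const,
      card_range, nsmul_eq_mul, mul_one, smul_eq_mul]
    exact ENNReal.inv_mul_cancel (by exact_mod_cast hN n) (ENNReal.natCast_ne_top _)⟩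
  have h_integral : ∀ {E : Type} [NormedAddCommGroup E] [NormedSpace ℝ E] [CompleteSpace E]
      (f : ℝ → E) (n : ℕ), ∫ x, f x ∂(ν n) = (N n : ℝ)⁻¹ • ∑ m ∈ range (N n), f (Y n m) := by
    intro E _ _ _ f n
    simp only [ν]
    rw [integral_smul_measure, integral_finsetSum_measure]
    · simp
    · intro i _
      exact integrable_dirac (by simp)
  let P : ℕ → ProbabilityMeasure ℝ := fun n => ⟨ν n, hν n⟩
  let P₀ : ProbabilityMeasure ℝ := ⟨gaussianReal 0 1, inferInstance⟩
  have key : Tendsto P atTop (𝓝 P₀) := by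
    refine ProbabilityMeasure.tendsto_iff_tendsto_charFun.2 fun t => ?_
    simp only [P, P₀, ProbabilityMeasure.coe_mk, charFun_gaussianReal, charFun_apply_real (μ := ν _),
      h_integral]
    convert h t using 2
    · rw [div_eq_inv_mul, Complex.real_smul]; push_cast; rfl
    · simp [neg_div]
  have := ProbabilityMeasure.tendsto_iff_forall_integral_tendsto.1 key g
  simp only [P, P₀, ProbabilityMeasure.coe_mk, h_integral] at this
  simpa only [smul_eq_mul, div_eq_inv_mul] using this

theorem stmt4 :
    -- the random variable `X_n` on the uniform space `{0, …, (n+1)! − 1}`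
    ∀ X : ℕ → ℕ → ℝ, (X = fun n m => (factorialSummands n m : ℝ)) →
    -- its mean `μ_n`
    ∀ μ : ℕ → ℝ, (μ = fun n =>
      (∑ m ∈ range (Nat.factorial (n + 1)), X n m) / (Nat.factorial (n + 1) : ℝ)) →
    -- its standard deviation `σ_n`
    ∀ σ : ℕ → ℝ, (σ = fun n => Real.sqrt
      ((∑ m ∈ range (Nat.factorial (n + 1)), (X n m - μ n) ^ 2) /
        (Nat.factorial (n + 1) : ℝ))) →
    -- `(X_n − μ_n)/σ_n` converges in distribution to the standard normal:
    -- for every bounded continuous test function, expectations converge to the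
    -- Gaussian integral
    ∀ g : BoundedContinuousFunction ℝ ℝ,
      Filter.Tendsto
        (fun n => (∑ m ∈ range (Nat.factorial (n + 1)),
            g ((X n m - μ n) / σ n)) / (Nat.factorial (n + 1) : ℝ))
        Filter.atTop
        (nhds (∫ x, g x ∂(ProbabilityTheory.gaussianReal 0 1))) := by

  intro X hX μ hμ σ hσ g
  subst hX
  have hf : ∀ n : ℕ, ((n + 1).factorial : ℝ) ≠ 0 := fun n => by
    exact_mod_cast (n + 1).factorial_ne_zero
  have hmean : μ = digitMean := by
    rw [hμ]; funext n
    rw [sum_factorialSummands, mul_div_cancel_left₀ _ (hf n)]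
  subst hmean
  have hsd : σ = fun n => √(digitVariance n) := by
    rw [hσ]; funext n
    rw [sum_factorialSummands_sub_sq, mul_div_cancel_left₀ _ (hf n)]
  subst hsd
  refine tendsto_average_of_tendsto_charFun (N := fun n => (n + 1).factorial)
    (Y := fun n m => ((factorialSummands n m : ℝ) - digitMean n) / √(digitVariance n))
    (fun n => (n + 1).factorial_ne_zero) (fun t => ?_) g
  refine (tendsto_digitCharFun_div_sqrt t).congr fun n => ?_
  simp only [digitCharFun, mul_div_assoc', div_mul_eq_mul_div]
end

section
/- For n ≥ 1 define the unsigned Stirling numbers of the first kind c(n, k) by the polynomial identity ∏_{i=0}^{n−1} (X + i) = ∑_{k=0}^{n} c(n, k) X^k in ℤ[X]. Let W_n be the random variable on {0, 1, …, n} with P(W_n = k) = c(n, k)/n!. Then, with μ_n and σ_n the mean and standard deviation of W_n, the normalized random variables (W_n − μ_n)/σ_n converge in distribution to the standard normal distribution N(0,1) as n → ∞. -/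
open Finset Polynomial

/-- Unsigned Stirling numbers of the first kind, defined via
`∏_{i=0}^{n−1} (X + i) = ∑_{k=0}^{n} c(n,k) X^k` in `ℤ[X]`. -/
noncomputable def stirlingFirst (n k : ℕ) : ℤ :=
  (∏ i ∈ Finset.range n, (Polynomial.X + Polynomial.C (i : ℤ))).coeff k

open Filter Topology MeasureTheory ProbabilityTheory

lemma stirlingFirst_zero (k : ℕ) : stirlingFirst 0 k = if k = 0 then 1 else 0 := by
  simp [stirlingFirst, coeff_one]

lemma stirlingFirst_succ_zero (n : ℕ) :
    stirlingFirst (n + 1) 0 = n * stirlingFirst n 0 := by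
  simp [stirlingFirst, prod_range_succ, mul_comm]

lemma stirlingFirst_succ_succ (n k : ℕ) :
    stirlingFirst (n + 1) (k + 1) = stirlingFirst n k + n * stirlingFirst n (k + 1) := by
  rw [stirlingFirst, prod_range_succ, mul_add, coeff_add, coeff_mul_X, coeff_mul_C, mul_comm (n : ℤ)]
  rfl

lemma stirlingFirst_nonneg (n k : ℕ) : 0 ≤ stirlingFirst n k := by
  induction n generalizing k with
  | zero => rw [stirlingFirst_zero]; split_ifs <;> simp
  | succ n ih =>
    cases k with
    | zero => rw [stirlingFirst_succ_zero]; exact mul_nonneg (by positivity) (ih 0)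
    | succ k =>
      rw [stirlingFirst_succ_succ]
      exact add_nonneg (ih k) (mul_nonneg (by positivity) (ih (k + 1)))

lemma stirlingFirst_eq_zero_of_lt {n k : ℕ} (h : n < k) : stirlingFirst n k = 0 := by
  induction n generalizing k with
  | zero => simp [stirlingFirst_zero, h.ne']
  | succ n ih =>
    obtain ⟨k, rfl⟩ := Nat.exists_eq_succ_of_ne_zero (Nat.ne_zero_of_lt h)
    rw [Nat.succ_eq_add_one, stirlingFirst_succ_succ, ih (by omega), ih (by omega)]
    simp

/-- The probability `c(n,k)/n!` that a uniform permutation of `n` elements has `k` cycles. -/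
noncomputable def stirlingProb (n k : ℕ) : ℝ := (stirlingFirst n k : ℝ) / (Nat.factorial n : ℝ)

lemma stirlingProb_nonneg (n k : ℕ) : 0 ≤ stirlingProb n k :=
  div_nonneg (by exact_mod_cast stirlingFirst_nonneg n k) (by positivity)

/-- Expectations under `stirlingProb (n + 1)`: an independent Bernoulli variable of parameter
`1 / (n + 1)` is added. -/
lemma sum_stirlingProb_succ_smul {E : Type*} [AddCommGroup E] [Module ℝ E] (n : ℕ) (f : ℕ → E) :
    ∑ k ∈ range (n + 2), stirlingProb (n + 1) k • f k =
      (1 - 1 / (n + 1 : ℝ)) • ∑ k ∈ range (n + 1), stirlingProb n k • f k +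
      (1 / (n + 1 : ℝ)) • ∑ k ∈ range (n + 1), stirlingProb n k • f (k + 1) := by
  have hn : (n + 1 : ℝ) ≠ 0 := by positivity
  have hfact : (n.factorial : ℝ) ≠ 0 := by positivity
  have h_zero : stirlingProb (n + 1) 0 = (1 - 1 / (n + 1 : ℝ)) * stirlingProb n 0 := by
    simp only [stirlingProb, stirlingFirst_succ_zero, Nat.factorial_succ]
    push_cast
    field_simp
    ring
  have h_succ (k : ℕ) : stirlingProb (n + 1) (k + 1) =
      (1 - 1 / (n + 1 : ℝ)) * stirlingProb n (k + 1) + 1 / (n + 1 : ℝ) * stirlingProb n k := by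
    simp only [stirlingProb, stirlingFirst_succ_succ, Nat.factorial_succ]
    push_cast
    field_simp
    ring
  have h_last : stirlingProb n (n + 1) = 0 := by
    simp [stirlingProb, stirlingFirst_eq_zero_of_lt (Nat.lt_succ_self n)]
  have h_ext : ∑ k ∈ range (n + 1), stirlingProb n k • f k =
      ∑ k ∈ range (n + 2), stirlingProb n k • f k := by
    rw [sum_range_succ _ (n + 1), h_last, zero_smul, add_zero]
  rw [h_ext, sum_range_succ', sum_range_succ' _ (n + 1)]
  simp only [h_zero, h_succ, add_smul, mul_smul, sum_add_distrib, smul_add, smul_sum]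
  abel

lemma sum_stirlingProb (n : ℕ) : ∑ k ∈ range (n + 1), stirlingProb n k = 1 := by
  induction n with
  | zero => simp [stirlingProb, stirlingFirst_zero]
  | succ n ih =>
    have h := sum_stirlingProb_succ_smul n (fun _ ↦ (1 : ℝ))
    simp only [smul_eq_mul, mul_one, ih] at h
    rw [h]
    ring

lemma sum_mul_stirlingProb (n : ℕ) :
    ∑ k ∈ range (n + 1), (k : ℝ) * stirlingProb n k = ∑ i ∈ range n, 1 / (i + 1 : ℝ) := by
  induction n with
  | zero => simp
  | succ n ih =>
    have h := sum_stirlingProb_succ_smul n (fun k ↦ (k : ℝ))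
    simp only [smul_eq_mul, Nat.cast_add, Nat.cast_one, mul_add, mul_one, sum_add_distrib,
      sum_stirlingProb] at h
    simp only [mul_comm (stirlingProb _ _), ih] at h
    rw [h, sum_range_succ]
    ring

lemma sum_sq_mul_stirlingProb (n : ℕ) :
    ∑ k ∈ range (n + 1), (k : ℝ) ^ 2 * stirlingProb n k =
      (∑ i ∈ range n, 1 / (i + 1 : ℝ)) ^ 2 +
        ∑ i ∈ range n, 1 / (i + 1 : ℝ) * (1 - 1 / (i + 1 : ℝ)) := by
  induction n with
  | zero => simp
  | succ n ih =>
    have h := sum_stirlingProb_succ_smul n (fun k ↦ (k : ℝ) ^ 2)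
    have h_shift : ∑ k ∈ range (n + 1), stirlingProb n k * ((k + 1 : ℕ) : ℝ) ^ 2 =
        ∑ k ∈ range (n + 1), (k : ℝ) ^ 2 * stirlingProb n k +
          2 * ∑ k ∈ range (n + 1), (k : ℝ) * stirlingProb n k +
          ∑ k ∈ range (n + 1), stirlingProb n k := by
      rw [mul_sum, ← sum_add_distrib, ← sum_add_distrib]
      refine sum_congr rfl fun k _ ↦ ?_
      push_cast
      ring
    simp only [smul_eq_mul] at h
    rw [h_shift, sum_stirlingProb, sum_mul_stirlingProb] at h
    simp only [mul_comm (stirlingProb _ _), ih] at h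
    rw [h, sum_range_succ, sum_range_succ]
    ring

lemma sum_sub_sq_mul_stirlingProb (n : ℕ) :
    ∑ k ∈ range (n + 1), ((k : ℝ) - ∑ i ∈ range n, 1 / (i + 1 : ℝ)) ^ 2 * stirlingProb n k =
      ∑ i ∈ range n, 1 / (i + 1 : ℝ) * (1 - 1 / (i + 1 : ℝ)) := by
  have h_expand (m : ℝ) : ∑ k ∈ range (n + 1), ((k : ℝ) - m) ^ 2 * stirlingProb n k =
      ∑ k ∈ range (n + 1), (k : ℝ) ^ 2 * stirlingProb n k -
        2 * m * ∑ k ∈ range (n + 1), (k : ℝ) * stirlingProb n k +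
        m ^ 2 * ∑ k ∈ range (n + 1), stirlingProb n k := by
    rw [mul_sum, mul_sum, ← sum_sub_distrib, ← sum_add_distrib]
    exact sum_congr rfl fun k _ ↦ by ring
  rw [h_expand, sum_sq_mul_stirlingProb, sum_mul_stirlingProb, sum_stirlingProb]
  ring

lemma sum_stirlingProb_mul_pow (n : ℕ) (z : ℂ) :
    ∑ k ∈ range (n + 1), (stirlingProb n k : ℂ) * z ^ k =
      ∏ i ∈ range n, (1 + ((1 / (i + 1 : ℝ) : ℝ) : ℂ) * (z - 1)) := by
  induction n with
  | zero => simp [stirlingProb, stirlingFirst_zero]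
  | succ n ih =>
    have h := sum_stirlingProb_succ_smul n (fun k ↦ z ^ k)
    simp only [Complex.real_smul, pow_succ, ← mul_assoc, ← sum_mul, ih] at h
    rw [h, prod_range_succ]
    push_cast
    ring

lemma norm_prod_sub_prod_le_sum {ι : Type*} (s : Finset ι) {a b : ι → ℂ}
    (ha : ∀ i ∈ s, ‖a i‖ ≤ 1) (hb : ∀ i ∈ s, ‖b i‖ ≤ 1) :
    ‖∏ i ∈ s, a i - ∏ i ∈ s, b i‖ ≤ ∑ i ∈ s, ‖a i - b i‖ := by
  classical
  induction s using Finset.induction_on with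
  | empty => simp
  | insert j s hj ih =>
    rw [prod_insert hj, prod_insert hj, sum_insert hj]
    have ha_prod : ‖∏ i ∈ s, a i‖ ≤ 1 := by
      rw [norm_prod]
      exact prod_le_one (fun _ _ ↦ norm_nonneg _) fun i hi ↦ ha i (mem_insert_of_mem hi)
    have h_ih := ih (fun i hi ↦ ha i (mem_insert_of_mem hi))
      (fun i hi ↦ hb i (mem_insert_of_mem hi))
    have hbj := hb j (mem_insert_self j s)
    calc ‖a j * ∏ i ∈ s, a i - b j * ∏ i ∈ s, b i‖
        = ‖(a j - b j) * ∏ i ∈ s, a i + b j * (∏ i ∈ s, a i - ∏ i ∈ s, b i)‖ := by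
          congr 1; ring
      _ ≤ ‖a j - b j‖ * ‖∏ i ∈ s, a i‖ + ‖b j‖ * ‖∏ i ∈ s, a i - ∏ i ∈ s, b i‖ := by
          rw [← norm_mul, ← norm_mul]
          exact norm_add_le _ _
      _ ≤ ‖a j - b j‖ * 1 + 1 * ∑ i ∈ s, ‖a i - b i‖ := by gcongr
      _ = ‖a j - b j‖ + ∑ i ∈ s, ‖a i - b i‖ := by ring

/-- The characteristic function at `s` of a centered Bernoulli variable of parameter `p`. -/
noncomputable def bernoulliCharFun (p s : ℝ) : ℂ :=
  Complex.exp (-(s * p * Complex.I)) * (1 + p * (Complex.exp (s * Complex.I) - 1))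

lemma bernoulliCharFun_eq (p s : ℝ) :
    bernoulliCharFun p s = (1 - p) * Complex.exp ((-(s * p) : ℝ) * Complex.I) +
      p * Complex.exp ((s * (1 - p) : ℝ) * Complex.I) := by
  have h : ((s * (1 - p) : ℝ) : ℂ) * Complex.I =
      -(s * p * Complex.I) + s * Complex.I := by push_cast; ring
  rw [h, Complex.exp_add, bernoulliCharFun]
  push_cast
  rw [neg_mul]
  ring

lemma norm_bernoulliCharFun_le_one {p : ℝ} (hp0 : 0 ≤ p) (hp1 : p ≤ 1) (s : ℝ) :
    ‖bernoulliCharFun p s‖ ≤ 1 := by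
  rw [bernoulliCharFun_eq]
  refine (norm_add_le _ _).trans ?_
  rw [norm_mul, norm_mul, Complex.norm_exp_ofReal_mul_I, Complex.norm_exp_ofReal_mul_I,
    ← Complex.ofReal_one, ← Complex.ofReal_sub, Complex.norm_real, Complex.norm_real,
    Real.norm_of_nonneg hp0, Real.norm_of_nonneg (sub_nonneg.2 hp1)]
  linarith

lemma norm_exp_mul_I_sub_taylor_two_le {x : ℝ} (hx : |x| ≤ 1) :
    ‖Complex.exp (x * Complex.I) - (1 + x * Complex.I - x ^ 2 / 2)‖ ≤ |x| ^ 3 := by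
  have h_norm : ‖(x : ℂ) * Complex.I‖ = |x| := by simp
  have h := Complex.exp_bound (x := x * Complex.I) (by rwa [h_norm]) (n := 3) (by norm_num)
  rw [h_norm] at h
  have h_taylor : ∑ m ∈ range 3, ((x : ℂ) * Complex.I) ^ m / m.factorial =
      1 + x * Complex.I - x ^ 2 / 2 := by
    simp [sum_range_succ, mul_pow]
    ring
  rw [h_taylor] at h
  refine h.trans (mul_le_of_le_one_right (by positivity) ?_)
  norm_num [Nat.factorial]

lemma norm_bernoulliCharFun_sub_exp_le {p s : ℝ} (hp0 : 0 ≤ p) (hp1 : p ≤ 1) (hs : |s| ≤ 1) :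
    ‖bernoulliCharFun p s - Complex.exp ((-(s ^ 2 * (p * (1 - p)) / 2) : ℝ))‖ ≤
      3 * (p * |s| ^ 3) := by
  have hq0 : 0 ≤ 1 - p := sub_nonneg.2 hp1
  have hq1 : 1 - p ≤ 1 := by linarith
  have hs0 := abs_nonneg s
  have h_abs₁ : |-(s * p)| = |s| * p := by rw [abs_neg, abs_mul, abs_of_nonneg hp0]
  have h_abs₂ : |s * (1 - p)| = |s| * (1 - p) := by rw [abs_mul, abs_of_nonneg hq0]
  have h₁ := norm_exp_mul_I_sub_taylor_two_le (x := -(s * p)) (by rw [h_abs₁]; nlinarith)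
  have h₂ := norm_exp_mul_I_sub_taylor_two_le (x := s * (1 - p)) (by rw [h_abs₂]; nlinarith)
  rw [h_abs₁] at h₁
  rw [h_abs₂] at h₂
  set u : ℝ := s ^ 2 * (p * (1 - p)) / 2 with hu
  have hs2 : s ^ 2 ≤ 1 := by rw [← sq_abs]; exact pow_le_one₀ hs0 hs
  have hpq : p * (1 - p) ≤ p := mul_le_of_le_one_right hp0 hq1
  have hu0 : 0 ≤ u := by positivity
  have hu_le : u ≤ s ^ 2 * p := by
    have := mul_le_mul_of_nonneg_left hpq (sq_nonneg s)
    have : 0 ≤ s ^ 2 * (p * (1 - p)) := by positivity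
    linarith
  have hu1 : u ≤ 1 := hu_le.trans (mul_le_one₀ hs2 hp0 hp1)
  have hs43 : |s| ^ 4 ≤ |s| ^ 3 := pow_le_pow_of_le_one hs0 hs (by norm_num)
  have h₃ : ‖Complex.exp ((-u : ℝ)) - 1 - ((-u : ℝ) : ℂ)‖ ≤ p * |s| ^ 3 := by
    refine (Complex.norm_exp_sub_one_sub_id_le ?_).trans ?_
    · rw [Complex.norm_real, norm_neg, Real.norm_of_nonneg hu0]
      exact hu1
    · rw [Complex.norm_real, norm_neg, Real.norm_of_nonneg hu0]
      calc u ^ 2 ≤ (s ^ 2 * p) ^ 2 := by gcongr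
        _ = p ^ 2 * |s| ^ 4 := by rw [← sq_abs s]; ring
        _ ≤ p * |s| ^ 3 := by
          gcongr
          exact pow_le_of_le_one hp0 hp1 (by norm_num)
  set R₁ := Complex.exp ((-(s * p) : ℝ) * Complex.I) -
    (1 + (-(s * p) : ℝ) * Complex.I - (-(s * p) : ℝ) ^ 2 / 2) with hR₁
  set R₂ := Complex.exp ((s * (1 - p) : ℝ) * Complex.I) -
    (1 + (s * (1 - p) : ℝ) * Complex.I - (s * (1 - p) : ℝ) ^ 2 / 2) with hR₂
  set R₃ := Complex.exp ((-u : ℝ)) - 1 - ((-u : ℝ) : ℂ) with hR₃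
  have h_split : bernoulliCharFun p s - Complex.exp ((-u : ℝ)) =
      ((1 - p : ℝ) : ℂ) * R₁ + (p : ℂ) * R₂ - R₃ := by
    rw [bernoulliCharFun_eq, hR₁, hR₂, hR₃, hu]
    push_cast
    ring
  rw [h_split]
  calc ‖((1 - p : ℝ) : ℂ) * R₁ + (p : ℂ) * R₂ - R₃‖
      ≤ (1 - p) * ‖R₁‖ + p * ‖R₂‖ + ‖R₃‖ := by
        refine (norm_sub_le _ _).trans (add_le_add_left ((norm_add_le _ _).trans ?_) _)
        rw [norm_mul, norm_mul, Complex.norm_real, Complex.norm_real, Real.norm_of_nonneg hp0,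
          Real.norm_of_nonneg hq0]
    _ ≤ 1 * (|s| * p) ^ 3 + p * (|s| * 1) ^ 3 + p * |s| ^ 3 := by
        gcongr
        exact h₂.trans (by gcongr)
    _ ≤ 3 * (p * |s| ^ 3) := by
        have hp3 : p ^ 3 ≤ p := pow_le_of_le_one hp0 hp1 (by norm_num)
        have := mul_le_mul_of_nonneg_right hp3 (pow_nonneg hs0 3)
        nlinarith

/-- Lindeberg-type comparison for sums of independent centered Bernoulli variables. -/
lemma norm_prod_bernoulliCharFun_sub_exp_le {ι : Type*} (A : Finset ι) {p : ι → ℝ}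
    (hp0 : ∀ i, 0 ≤ p i) (hp1 : ∀ i, p i ≤ 1) {s : ℝ} (hs : |s| ≤ 1) :
    ‖∏ i ∈ A, bernoulliCharFun (p i) s -
        Complex.exp ((-(s ^ 2 * (∑ i ∈ A, p i * (1 - p i)) / 2) : ℝ))‖ ≤
      3 * ((∑ i ∈ A, p i) * |s| ^ 3) := by
  have h_exp : Complex.exp ((-(s ^ 2 * (∑ i ∈ A, p i * (1 - p i)) / 2) : ℝ)) =
      ∏ i ∈ A, Complex.exp ((-(s ^ 2 * (p i * (1 - p i)) / 2) : ℝ)) := by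
    rw [← Complex.exp_sum, ← Complex.ofReal_sum, sum_neg_distrib, mul_sum, sum_div]
  rw [h_exp]
  refine (norm_prod_sub_prod_le_sum A (fun i _ ↦ norm_bernoulliCharFun_le_one (hp0 i) (hp1 i) s)
    fun i _ ↦ ?_).trans ?_
  · rw [← Complex.ofReal_exp, Complex.norm_real, Real.norm_of_nonneg (Real.exp_pos _).le,
      Real.exp_le_one_iff, neg_nonpos]
    have := hp0 i
    have := sub_nonneg.2 (hp1 i)
    positivity
  · rw [sum_mul, mul_sum]
    exact sum_le_sum fun i _ ↦ norm_bernoulliCharFun_sub_exp_le (hp0 i) (hp1 i) hs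

lemma tendsto_prod_bernoulliCharFun {p : ℕ → ℝ} (hp0 : ∀ i, 0 ≤ p i) (hp1 : ∀ i, p i ≤ 1)
    (hp_sum : Tendsto (fun n ↦ ∑ i ∈ range n, p i) atTop atTop)
    (hp_sq : Summable fun i ↦ p i ^ 2) (t : ℝ) :
    Tendsto (fun n ↦ ∏ i ∈ range n,
      bernoulliCharFun (p i) (t / √(∑ i ∈ range n, p i * (1 - p i)))) atTop
      (𝓝 (Complex.exp (-t ^ 2 / 2))) := by
  set V : ℕ → ℝ := fun n ↦ ∑ i ∈ range n, p i * (1 - p i) with hV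
  set C := ∑' i, p i ^ 2
  have hH_le (n : ℕ) : ∑ i ∈ range n, p i ≤ V n + C := by
    have h_eq : ∑ i ∈ range n, p i = V n + ∑ i ∈ range n, p i ^ 2 := by
      rw [hV, ← sum_add_distrib]
      exact sum_congr rfl fun i _ ↦ by ring
    rw [h_eq]
    gcongr
    exact hp_sq.sum_le_tsum _ fun i _ ↦ sq_nonneg _
  have hV_top : Tendsto V atTop atTop := by
    refine tendsto_atTop_mono (fun n ↦ ?_) (tendsto_atTop_add_const_right _ (-C) hp_sum)
    linarith [hH_le n]
  have h_sqrt : Tendsto (fun n ↦ √(V n)) atTop atTop := Real.tendsto_sqrt_atTop.comp hV_top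
  have h_scale : Tendsto (fun n ↦ |t / √(V n)|) atTop (𝓝 0) := by
    simpa using (h_sqrt.const_div_atTop t).abs
  have h_bound : Tendsto (fun n ↦ 3 * ((t ^ 2 + C * |t / √(V n)| ^ 2) * |t / √(V n)|)) atTop
      (𝓝 0) := by
    simpa using ((((h_scale.pow 2).const_mul C).const_add (t ^ 2)).mul h_scale).const_mul 3
  refine tendsto_iff_norm_sub_tendsto_zero.2 (squeeze_zero' (by simp) ?_ h_bound)
  filter_upwards [h_scale.eventually_le_const one_pos, hV_top.eventually_gt_atTop 0] with n hs hVn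
  have h_sq : (t / √(V n)) ^ 2 * V n = t ^ 2 := by
    rw [div_pow, Real.sq_sqrt hVn.le, div_mul_cancel₀ _ hVn.ne']
  have h := norm_prod_bernoulliCharFun_sub_exp_le (range n) hp0 hp1 hs
  rw [show ∑ i ∈ range n, p i * (1 - p i) = V n from rfl, h_sq] at h
  have h_cast : ((-(t ^ 2 / 2) : ℝ) : ℂ) = -t ^ 2 / 2 := by push_cast; ring
  rw [h_cast] at h
  refine h.trans ?_
  calc 3 * ((∑ i ∈ range n, p i) * |t / √(V n)| ^ 3)
      ≤ 3 * ((V n + C) * |t / √(V n)| ^ 3) := by gcongr; exact hH_le n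
    _ = 3 * (((t / √(V n)) ^ 2 * V n + C * |t / √(V n)| ^ 2) * |t / √(V n)|) := by
        rw [← sq_abs (t / √(V n))]; ring
    _ = _ := by rw [h_sq]

/-- The law of `(W_n - m) / s`, where `W_n` has weights `stirlingProb n`. -/
noncomputable def stirlingMeasure (n : ℕ) (m s : ℝ) : Measure ℝ :=
  ∑ k ∈ range (n + 1), ENNReal.ofReal (stirlingProb n k) • Measure.dirac ((k - m) / s)

instance (n : ℕ) (m s : ℝ) : IsProbabilityMeasure (stirlingMeasure n m s) where
  measure_univ := by
    simp only [stirlingMeasure, Measure.coe_finsetSum, Finset.sum_apply, Measure.smul_apply,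
      measure_univ, smul_eq_mul, mul_one]
    rw [← ENNReal.ofReal_sum_of_nonneg fun k _ ↦ stirlingProb_nonneg n k, sum_stirlingProb,
      ENNReal.ofReal_one]

lemma integral_stirlingMeasure {E : Type*} [NormedAddCommGroup E] [NormedSpace ℝ E]
    [CompleteSpace E] (n : ℕ) (m s : ℝ) (f : ℝ → E) :
    ∫ x, f x ∂(stirlingMeasure n m s) =
      ∑ k ∈ range (n + 1), stirlingProb n k • f ((k - m) / s) := by
  rw [stirlingMeasure, integral_finsetSum_measure]
  · refine sum_congr rfl fun k _ ↦ ?_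
    rw [integral_smul_measure, integral_dirac, ENNReal.toReal_ofReal (stirlingProb_nonneg n k)]
  · exact fun k _ ↦ (integrable_dirac (by simp)).smul_measure ENNReal.ofReal_ne_top

lemma charFun_stirlingMeasure (n : ℕ) (s t : ℝ) :
    charFun (stirlingMeasure n (∑ i ∈ range n, 1 / (i + 1 : ℝ)) s) t =
      ∏ i ∈ range n, bernoulliCharFun (1 / (i + 1 : ℝ)) (t / s) := by
  rw [charFun_apply_real, integral_stirlingMeasure]
  simp only [bernoulliCharFun]
  rw [prod_mul_distrib, ← Complex.exp_sum, ← sum_stirlingProb_mul_pow, mul_sum]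
  refine sum_congr rfl fun k _ ↦ ?_
  rw [Complex.real_smul, mul_left_comm, ← Complex.exp_nat_mul, ← Complex.exp_add,
    sum_neg_distrib, ← sum_mul, ← mul_sum, ← Complex.ofReal_sum]
  congr 2
  push_cast
  ring

lemma tendsto_stirlingMeasure :
    Tendsto (β := ProbabilityMeasure ℝ)
      (fun n ↦ ⟨stirlingMeasure n (∑ i ∈ range n, 1 / (i + 1 : ℝ))
        √(∑ i ∈ range n, 1 / (i + 1 : ℝ) * (1 - 1 / (i + 1 : ℝ))), inferInstance⟩)
      atTop (𝓝 ⟨gaussianReal 0 1, inferInstance⟩) := by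
  refine ProbabilityMeasure.tendsto_iff_tendsto_charFun.2 fun t ↦ ?_
  have h_sq : Summable fun i : ℕ ↦ (1 / (i + 1 : ℝ)) ^ 2 := by
    have h := (summable_nat_add_iff 1).2 (Real.summable_one_div_nat_pow.2 one_lt_two)
    simpa using h
  have h := tendsto_prod_bernoulliCharFun (p := fun i ↦ 1 / (i + 1 : ℝ)) (fun i ↦ by positivity)
    (fun i ↦ (div_le_one (by positivity)).2 (by simp))
    Real.tendsto_sum_range_one_div_nat_succ_atTop h_sq t
  simp only [ProbabilityMeasure.coe_mk, charFun_stirlingMeasure]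
  simpa [charFun_gaussianReal, neg_div] using h

theorem stmt5 :
    -- the probability weights `P(W_n = k) = c(n,k)/n!`
    ∀ P : ℕ → ℕ → ℝ, (P = fun n k => (stirlingFirst n k : ℝ) / (Nat.factorial n : ℝ)) →
    -- the mean `μ_n` of `W_n`
    ∀ μ : ℕ → ℝ, (μ = fun n => ∑ k ∈ range (n + 1), (k : ℝ) * P n k) →
    -- the standard deviation `σ_n` of `W_n`
    ∀ σ : ℕ → ℝ, (σ = fun n =>
      Real.sqrt (∑ k ∈ range (n + 1), ((k : ℝ) - μ n) ^ 2 * P n k)) →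
    -- `(W_n − μ_n)/σ_n` converges in distribution to the standard normal:
    -- expectations of bounded continuous test functions converge to the Gaussian integral
    ∀ g : BoundedContinuousFunction ℝ ℝ,
      Filter.Tendsto
        (fun n => ∑ k ∈ range (n + 1), P n k * g (((k : ℝ) - μ n) / σ n))
        Filter.atTop
        (nhds (∫ x, g x ∂(ProbabilityTheory.gaussianReal 0 1))) := by
  intro P hP μ hμ σ hσ g
  have hP' (n k : ℕ) : P n k = stirlingProb n k := by rw [hP]; rfl
  have hμ' (n : ℕ) : μ n = ∑ i ∈ range n, 1 / (i + 1 : ℝ) := by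
    simp only [hμ, hP', sum_mul_stirlingProb]
  have hσ' (n : ℕ) : σ n = √(∑ i ∈ range n, 1 / (i + 1 : ℝ) * (1 - 1 / (i + 1 : ℝ))) := by
    simp only [hσ, hP', hμ', sum_sub_sq_mul_stirlingProb]
  have h := ProbabilityMeasure.tendsto_iff_forall_integral_tendsto.1 tendsto_stirlingMeasure g
  simp only [ProbabilityMeasure.coe_mk, integral_stirlingMeasure, smul_eq_mul] at h
  simpa only [hP', hμ', hσ'] using h
end

section
/- Let b ≥ 3 be an integer, let f : ℕ → ℕ be f(n) = max(1, n mod b), and let a : ℕ → ℕ be the associated f-sequence. Then for all n ≥ 2b, a(n) + a(n − 2b) = (b+1) · a(n − b); equivalently, a satisfies the linear recurrence a(n) = (b+1)·a(n−b) − a(n−2b). -/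
/-- The term of the `f`-sequence just before index `q * b`, equal to `1` when `q = 0`. -/
def fSeqPred (f : ℕ → ℕ) (b q : ℕ) : ℕ :=
  if q = 0 then 1 else fSeq f (q * b - 1)

/-- Within one bin, the `f`-sequence of `n ↦ max 1 (n % b)` is an arithmetic progression. -/
theorem fSeq_bin (b : ℕ) (hb : 2 ≤ b) (q j : ℕ) (hj : j + 1 ≤ b) :
    fSeq (fun n => max 1 (n % b)) (q * b + (j + 1)) =
      (j + 1) * fSeq (fun n => max 1 (n % b)) (q * b) +
        fSeqPred (fun n => max 1 (n % b)) b q := by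
  induction j with
  | zero =>
    rw [zero_add, fSeq]
    rcases Nat.eq_zero_or_pos q with rfl | hq
    · simp [fSeqPred]
    · have h : 1 ≤ q * b := Nat.mul_pos hq (by omega)
      simp [fSeqPred, hq.ne', h]
  | succ j ih =>
    have hmod : (q * b + (j + 1)) % b = j + 1 := by
      rw [Nat.mul_add_mod_self_right, Nat.mod_eq_of_lt (by omega)]
    have hmax : max 1 (j + 1) = j + 1 := by omega
    rw [← add_assoc (q * b) (j + 1) 1, fSeq]
    simp only [hmod, hmax]
    rw [if_pos (by omega), Nat.add_sub_cancel, ih (by omega)]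
    ring

theorem fSeq_succ_bin (b : ℕ) (hb : 2 ≤ b) (q : ℕ) :
    fSeq (fun n => max 1 (n % b)) ((q + 1) * b) =
      b * fSeq (fun n => max 1 (n % b)) (q * b) +
        fSeqPred (fun n => max 1 (n % b)) b q := by
  obtain ⟨c, rfl⟩ : ∃ c, b = c + 1 := ⟨b - 1, by omega⟩
  rw [← fSeq_bin (c + 1) hb q c le_rfl, add_one_mul q]

theorem fSeqPred_succ_bin (b : ℕ) (hb : 2 ≤ b) (q : ℕ) :
    fSeqPred (fun n => max 1 (n % b)) b (q + 1) +
        fSeq (fun n => max 1 (n % b)) (q * b) =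
      b * fSeq (fun n => max 1 (n % b)) (q * b) +
        fSeqPred (fun n => max 1 (n % b)) b q := by
  obtain ⟨c, rfl⟩ : ∃ c, b = c + 2 := ⟨b - 2, by omega⟩
  have h := fSeq_bin (c + 2) hb q c (by omega)
  have hidx : (q + 1) * (c + 2) - 1 = q * (c + 2) + (c + 1) := by
    rw [add_one_mul]; omega
  rw [fSeqPred, if_neg (by omega), hidx, h]
  ring

theorem stmt8 (b : ℕ) (hb : 3 ≤ b) (f : ℕ → ℕ) (hf : f = fun n => max 1 (n % b)) :
    ∀ n, 2 * b ≤ n →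
      fSeq f n + fSeq f (n - 2 * b) = (b + 1) * fSeq f (n - b) := by
  subst hf
  intro n hn
  have hb2 : 2 ≤ b := by omega
  obtain ⟨q, r, hr, hqr⟩ : ∃ q r, r < b ∧ n - 2 * b = q * b + r :=
    ⟨(n - 2 * b) / b, (n - 2 * b) % b, Nat.mod_lt _ (by omega),
      (Nat.div_add_mod' _ _).symm⟩
  have h1 : n - b = (q + 1) * b + r := by rw [add_one_mul]; omega
  have h2 : n = (q + 1 + 1) * b + r := by rw [add_one_mul, add_one_mul]; omega
  rw [hqr, h1, h2]
  have x1 := fSeq_succ_bin b hb2 q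
  have x2 := fSeq_succ_bin b hb2 (q + 1)
  have y1 := fSeqPred_succ_bin b hb2 q
  have y2 := fSeqPred_succ_bin b hb2 (q + 1)
  cases r with
  | zero =>
    simp only [add_zero]
    linarith
  | succ j =>
    have hj : j + 1 ≤ b := hr.le
    rw [fSeq_bin b hb2 q j hj, fSeq_bin b hb2 (q + 1) j hj, fSeq_bin b hb2 (q + 1 + 1) j hj]
    zify at *
    linear_combination ((j : ℤ) + 1) * (x2 - x1 + y1) + y2 - x1 + b * (x1 - y1)
end

section
/- Let b ≥ 3 be an integer and f(n) = max(1, n mod b). For n ≥ 0 and k ∈ ℤ, let p_{n,k} be the number of subsets S ⊆ {0, 1, …, bn − 1} with |S| = k that are f-legal, i.e., for any two distinct i, j ∈ S with j < i one has i − j > f(i); set p_{n,k} = 0 when k < 0 or n < 0. Then for all n ≥ 2 and all k, p_{n,k} + p_{n−2, k−2} = p_{n−1, k} + b · p_{n−1, k−1}. -/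
instance (f : ℕ → ℕ) (S : Finset ℕ) : Decidable (FLegal f S) := by
  unfold FLegal; infer_instance

/-- `pCount b n k`: the number of `f`-legal `k`-element subsets of `{0, …, b*n − 1}`,
where `f m = max 1 (m % b)`; it is `0` for `k < 0`. -/
def pCount (b : ℕ) (n : ℕ) (k : ℤ) : ℤ :=
  if 0 ≤ k then
    (((Finset.range (b * n)).powersetCard k.toNat).filter
      (fun S => FLegal (fun m => max 1 (m % b)) S)).card
  else 0

/-- The `f`-legal `k`-element subsets of `{0, …, m − 1}`. -/
def legalSets (f : ℕ → ℕ) (m k : ℕ) : Finset (Finset ℕ) :=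
  ((Finset.range m).powersetCard k).filter (fun S => FLegal f S)

theorem mem_legalSets {f : ℕ → ℕ} {m k : ℕ} {S : Finset ℕ} :
    S ∈ legalSets f m k ↔ (S ⊆ Finset.range m ∧ S.card = k) ∧ FLegal f S := by
  simp [legalSets, Finset.mem_powersetCard]

/-- The number of `f`-legal `k`-element subsets of `{0, …, m − 1}`, zero for `k < 0`. -/
def legalCount (f : ℕ → ℕ) (m : ℕ) (k : ℤ) : ℤ :=
  if 0 ≤ k then ((legalSets f m k.toNat).card : ℤ) else 0

theorem legalSets_succ_succ (f : ℕ → ℕ) (m k : ℕ) :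
    legalSets f (m + 1) (k + 1) =
      legalSets f m (k + 1) ∪ (legalSets f (m - f m) k).image (insert m) := by
  ext S
  simp only [Finset.mem_union, Finset.mem_image, mem_legalSets]
  constructor
  · rintro ⟨⟨hS, hc⟩, hL⟩
    by_cases hm : m ∈ S
    · refine Or.inr ⟨S.erase m, ⟨⟨fun j hj => ?_, ?_⟩, hL.mono (S.erase_subset m)⟩,
        Finset.insert_erase hm⟩
      · obtain ⟨hne, hj⟩ := Finset.mem_erase.1 hj
        have h1 := Finset.mem_range.1 (hS hj)
        have h2 := hL m hm j hj (by omega)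
        exact Finset.mem_range.2 (by omega)
      · rw [Finset.card_erase_of_mem hm, hc, Nat.add_sub_cancel]
    · refine Or.inl ⟨⟨fun j hj => ?_, hc⟩, hL⟩
      have h1 := Finset.mem_range.1 (hS hj)
      have h2 : j ≠ m := fun h => hm (h ▸ hj)
      exact Finset.mem_range.2 (by omega)
  · rintro (⟨⟨hS, hc⟩, hL⟩ | ⟨T, ⟨⟨hT, hc⟩, hL⟩, rfl⟩)
    · exact ⟨⟨hS.trans (Finset.range_subset_range.2 m.le_succ), hc⟩, hL⟩
    · have hlt : ∀ j ∈ T, j < m - f m := fun j hj => Finset.mem_range.1 (hT hj)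
      have hm : m ∉ T := fun h => by have := hlt m h; omega
      refine ⟨⟨fun j hj => ?_, by rw [Finset.card_insert_of_notMem hm, hc]⟩, ?_⟩
      · rcases Finset.mem_insert.1 hj with rfl | hj
        · simp
        · have := hlt j hj
          exact Finset.mem_range.2 (by omega)
      · intro i hi j hj hji
        rcases Finset.mem_insert.1 hi with rfl | hiT <;> rcases Finset.mem_insert.1 hj with rfl | hjT
        · omega
        · have := hlt j hjT
          omega
        · have := hlt i hiT
          omega
        · exact hL i hiT j hjT hji

theorem card_legalSets_succ_succ (f : ℕ → ℕ) (m k : ℕ) :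
    (legalSets f (m + 1) (k + 1)).card =
      (legalSets f m (k + 1)).card + (legalSets f (m - f m) k).card := by
  have hnot : ∀ T ∈ legalSets f (m - f m) k, m ∉ T := fun T hT h => by
    have := Finset.mem_range.1 ((mem_legalSets.1 hT).1.1 h)
    omega
  rw [legalSets_succ_succ, Finset.card_union_of_disjoint, Finset.card_image_of_injOn]
  · intro S hS T hT h
    rw [← Finset.erase_insert (hnot S hS), ← Finset.erase_insert (hnot T hT)]
    exact congrArg (fun U => Finset.erase U m) h
  · refine Finset.disjoint_left.2 fun S hS hS' => ?_
    obtain ⟨T, -, rfl⟩ := Finset.mem_image.1 hS'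
    have := (mem_legalSets.1 hS).1.1 (Finset.mem_insert_self m T)
    simp at this

theorem card_legalSets_zero (f : ℕ → ℕ) (m : ℕ) : (legalSets f m 0).card = 1 := by
  have h : FLegal f ∅ := fun i hi => absurd hi (Finset.notMem_empty i)
  simp [legalSets, Finset.filter_singleton, h]

/-- Splitting legal sets according to whether they contain the largest available index. -/
theorem legalCount_succ (f : ℕ → ℕ) (m : ℕ) (k : ℤ) :
    legalCount f (m + 1) k = legalCount f m k + legalCount f (m - f m) (k - 1) := by
  rcases lt_or_ge k 0 with hk | hk
  · simp only [legalCount, if_neg (show ¬ 0 ≤ k by omega),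
      if_neg (show ¬ 0 ≤ k - 1 by omega), add_zero]
  · obtain ⟨k, rfl⟩ := Int.eq_ofNat_of_zero_le hk
    cases k with
    | zero => simp [legalCount, card_legalSets_zero]
    | succ k =>
      have h := card_legalSets_succ_succ f m k
      have h1 : ((k + 1 : ℕ) : ℤ) - 1 = (k : ℤ) := by omega
      rw [h1]
      simp only [legalCount, Int.natCast_nonneg, if_true, Int.toNat_natCast]
      exact_mod_cast h

theorem legalCount_block (b n r : ℕ) (hr : r < b) (k : ℤ) :
    legalCount (fun m => max 1 (m % b)) (b * n + r + 1) k =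
      legalCount (fun m => max 1 (m % b)) (b * n) k +
        legalCount (fun m => max 1 (m % b)) (b * n - 1) (k - 1) +
        r * legalCount (fun m => max 1 (m % b)) (b * n) (k - 1) := by
  induction r with
  | zero =>
    rw [add_zero, legalCount_succ]
    simp
  | succ r ih =>
    have hmod : b * n + (r + 1) - max 1 ((b * n + (r + 1)) % b) = b * n := by
      rw [Nat.mul_add_mod, Nat.mod_eq_of_lt hr]
      omega
    rw [legalCount_succ, hmod, ← add_assoc, ih (by omega)]
    push_cast
    ring

theorem stmt9 (b : ℕ) (hb : 3 ≤ b) (n : ℕ) (hn : 2 ≤ n) (k : ℤ) :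
    pCount b n k + pCount b (n - 2) (k - 2) =
      pCount b (n - 1) k + b * pCount b (n - 1) (k - 1) := by
  obtain ⟨n, rfl⟩ := Nat.exists_eq_add_of_le' hn
  obtain ⟨c, rfl⟩ := Nat.exists_eq_add_of_le' (show 2 ≤ b by omega)
  have hp : ∀ n k, pCount (c + 2) n k =
      legalCount (fun m => max 1 (m % (c + 2))) ((c + 2) * n) k := fun _ _ => rfl
  have hblock := legalCount_block (c + 2) (n + 1) (c + 1) (by omega) k
  have hlast := legalCount_succ (fun m => max 1 (m % (c + 2)))
    ((c + 2) * n + (c + 1)) (k - 1)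
  have hmod : (c + 2) * n + (c + 1) - max 1 (((c + 2) * n + (c + 1)) % (c + 2)) =
      (c + 2) * n := by
    rw [Nat.mul_add_mod, Nat.mod_eq_of_lt (by omega)]
    omega
  simp only [hmod] at hlast
  have e1 : (c + 2) * (n + 1) + (c + 1) + 1 = (c + 2) * (n + 2) := by ring
  have e2 : (c + 2) * n + (c + 1) + 1 = (c + 2) * (n + 1) := by ring
  have e3 : (c + 2) * (n + 1) - 1 = (c + 2) * n + (c + 1) := by omega
  rw [e1, e3] at hblock
  rw [e2, show k - 1 - 1 = k - 2 by ring] at hlast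
  rw [show n + 2 - 2 = n by omega, show n + 2 - 1 = n + 1 by omega]
  simp only [hp]
  push_cast at hblock ⊢
  linear_combination hblock - hlast
end

section
/- Let f(n) = max(1, n mod 3) and let a : ℕ → ℕ be the associated f-sequence (a = 1, 2, 3, 4, 7, 11, 15, 26, 41, …). Then a satisfies no linear homogeneous recurrence relation with constant nonnegative integer coefficients: there do not exist h ≥ 1 and nonnegative integers d_1, …, d_h such that a(n) = ∑_{i=1}^{h} d_i · a(n − i) for all n ≥ h. -/
/-- The sequence underlying 3-bin decompositions. -/
abbrev binSeq : ℕ → ℕ := fSeq fun n => max 1 (n % 3)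

theorem binSeq_succ {n m : ℕ} (h : m + max 1 (n % 3) = n) :
    binSeq (n + 1) = binSeq n + binSeq m := by
  rw [binSeq, fSeq, if_pos (by omega), show n - max 1 (n % 3) = m by omega]

theorem binSeq_one : binSeq 1 = 2 := by simp [binSeq, fSeq]

theorem binSeq_three_mul_add_two (k : ℕ) :
    binSeq (3 * k + 2) = binSeq (3 * k + 1) + binSeq (3 * k) :=
  binSeq_succ (by omega)

theorem binSeq_three_mul_add_three (k : ℕ) :
    binSeq (3 * k + 3) = binSeq (3 * k + 2) + binSeq (3 * k) :=
  binSeq_succ (by omega)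

theorem binSeq_three_mul_add_four (k : ℕ) :
    binSeq (3 * k + 4) = binSeq (3 * k + 3) + binSeq (3 * k + 2) :=
  binSeq_succ (by omega)

/-- A combination of six consecutive shifts of `binSeq` which, when `μ ^ 2 = 4 * μ - 1`, is
supported on the multiples of three, where it is geometric with ratio `μ`. -/
def binComb (μ : ℝ) (n : ℕ) : ℝ :=
  (μ - 3) * binSeq n + (11 - 3 * μ) * binSeq (n + 1) + (11 - 3 * μ) * binSeq (n + 2) +
    (1 - μ) * binSeq (n + 3) + (μ - 3) * binSeq (n + 4) + (μ - 3) * binSeq (n + 5)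

theorem binComb_three_mul {μ : ℝ} (hμ : μ ^ 2 = 4 * μ - 1) (k : ℕ) :
    binComb μ (3 * k) = 2 * μ ^ k ∧ binComb μ (3 * k + 1) = 0 ∧ binComb μ (3 * k + 2) = 0 := by
  have step (k : ℕ) : (binSeq (3 * k + 2) : ℝ) = binSeq (3 * k + 1) + binSeq (3 * k) ∧
      (binSeq (3 * k + 3) : ℝ) = binSeq (3 * k + 2) + binSeq (3 * k) ∧
      (binSeq (3 * k + 4) : ℝ) = binSeq (3 * k + 3) + binSeq (3 * k + 2) :=
    ⟨mod_cast binSeq_three_mul_add_two k, mod_cast binSeq_three_mul_add_three k,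
      mod_cast binSeq_three_mul_add_four k⟩
  have key (k : ℕ) : (4 * μ - 14) * binSeq (3 * k) + (8 - 2 * μ) * binSeq (3 * k + 1) =
      2 * μ ^ k := by
    induction k with
    | zero => simp [binSeq_one, fSeq]; ring
    | succ k ih =>
      obtain ⟨h2, h3, h4⟩ := step k
      rw [show 3 * (k + 1) = 3 * k + 3 by ring, show 3 * k + 3 + 1 = 3 * k + 4 by ring, pow_succ,
        h4, h3, h2]
      linear_combination μ * ih + (2 * binSeq (3 * k + 1) - 4 * binSeq (3 * k) : ℝ) * hμ
  obtain ⟨h2, h3, h4⟩ := step k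
  obtain ⟨h5, h6, h7⟩ := step (k + 1)
  rw [show 3 * (k + 1) = 3 * k + 3 by ring] at h5 h6 h7
  simp only [add_assoc, Nat.reduceAdd] at h5 h6 h7
  have hk := key k
  simp only [binComb, add_assoc, Nat.reduceAdd, h2, h3, h4, h5, h6, h7]
  refine ⟨?_, ?_, ?_⟩
  · linear_combination hk
  · ring
  · ring

theorem stmt16 (f : ℕ → ℕ) (hf : f = fun n => max 1 (n % 3)) :
    ¬ ∃ (h : ℕ) (d : ℕ → ℕ), 1 ≤ h ∧
      ∀ n, h ≤ n → fSeq f n = ∑ i ∈ Finset.Icc 1 h, d i * fSeq f (n - i) := by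
  subst hf
  rintro ⟨h, d, -, hrec⟩
  replace hrec : ∀ n, h ≤ n → binSeq n = ∑ i ∈ Finset.Icc 1 h, d i * binSeq (n - i) := hrec
  obtain ⟨μ, hμ, hμ0, hμ1⟩ : ∃ μ : ℝ, μ ^ 2 = 4 * μ - 1 ∧ 0 < μ ∧ μ < 1 := by
    have hs : √(3 : ℝ) ^ 2 = 3 := Real.sq_sqrt (by norm_num)
    have hs0 := Real.sqrt_nonneg (3 : ℝ)
    exact ⟨2 - √3, by linear_combination hs, by nlinarith, by nlinarith⟩
  have hshift (j : ℕ) : (binSeq (3 * h + j) : ℝ) =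
      ∑ i ∈ Finset.Icc 1 h, (d i : ℝ) * binSeq (3 * h - i + j) := by
    rw [hrec (3 * h + j) (by omega)]
    push_cast
    refine Finset.sum_congr rfl fun i hi => ?_
    rw [Finset.mem_Icc] at hi
    rw [show 3 * h + j - i = 3 * h - i + j by omega]
  have hcomb : binComb μ (3 * h) = ∑ i ∈ Finset.Icc 1 h, (d i : ℝ) * binComb μ (3 * h - i) := by
    have h0 := hshift 0
    simp only [add_zero] at h0
    simp only [binComb, h0, hshift, Finset.mul_sum, ← Finset.sum_add_distrib]
    exact Finset.sum_congr rfl fun i _ => by ring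
  have hvalue (n : ℕ) : binComb μ n = 0 ∨ ∃ m, n = 3 * m ∧ binComb μ n = 2 * μ ^ m := by
    obtain ⟨h0, h1, h2⟩ := binComb_three_mul hμ (n / 3)
    rcases (by omega : n = 3 * (n / 3) ∨ n = 3 * (n / 3) + 1 ∨ n = 3 * (n / 3) + 2)
      with hn | hn | hn
    · exact Or.inr ⟨n / 3, hn, by rwa [← hn] at h0⟩
    · exact Or.inl (by rwa [← hn] at h1)
    · exact Or.inl (by rwa [← hn] at h2)
  have hnonneg (n : ℕ) : 0 ≤ binComb μ n := by
    rcases hvalue n with hn | ⟨m, -, hn⟩ <;> rw [hn]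
    positivity
  have hpos : binComb μ (3 * h) ≠ 0 := by
    rw [(binComb_three_mul hμ h).1]
    positivity
  obtain ⟨i, hi, hne⟩ := Finset.exists_ne_zero_of_sum_ne_zero (hcomb ▸ hpos)
  have hle : (d i : ℝ) * binComb μ (3 * h - i) ≤ binComb μ (3 * h) := by
    rw [hcomb]
    exact Finset.single_le_sum (f := fun i => (d i : ℝ) * binComb μ (3 * h - i))
      (fun i _ => mul_nonneg (Nat.cast_nonneg _) (hnonneg _)) hi
  have hd : (1 : ℝ) ≤ d i := by
    exact_mod_cast Nat.one_le_iff_ne_zero.mpr fun h0 => hne (by simp [h0])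
  obtain ⟨m, hm, hvm⟩ := (hvalue (3 * h - i)).resolve_left (right_ne_zero_of_mul hne)
  rw [Finset.mem_Icc] at hi
  have hlt : μ ^ h < μ ^ m := pow_lt_pow_right_of_lt_one₀ hμ0 hμ1 (by omega)
  have hge := le_mul_of_one_le_left (hnonneg (3 * h - i)) hd
  rw [(binComb_three_mul hμ h).1] at hle
  linarith
end
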